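/- arXiv:1712.07604 — 6 statements merged into one kernel-verified Lean document; each statement's English description precedes it below -/
import Mathlib

section
/- Let k ≥ 1 and let p_1,…,p_k, n_1,…,n_k be (not necessarily distinct) points of ℝ³. Assume, after relabeling, that the minimum defining L(𝒜) is attained by the identity permutation, i.e. L(𝒜) = Σ_{i=1}^k |p_i − n_i|. Then there exists a function ζ* defined on the finite set {p_1,…,p_k, n_1,…,n_k} with values in ℝ which is 1-Lipschitz (|ζ*(x) − ζ*(y)| ≤ |x − y| for all x, y in this set) such that Σ_{i=1}^k (ζ*(p_i) − ζ*(n_i)) = L(𝒜) and ζ*(n_i) = ζ*(p_i) − |p_i − n_i| for every i ∈ {1,…,k}. -/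
open scoped BigOperators

/-- If every permutation has nonnegative total weight, so does every closed walk. -/
lemma closedWalk_nonneg_of_perm_nonneg {ι : Type*} [Fintype ι] (w : ι → ι → ℝ)
    (hdiag : ∀ i, w i i = 0) (hperm : ∀ σ : Equiv.Perm ι, 0 ≤ ∑ i, w i (σ i)) (m : ℕ) :
    ∀ f : ℕ → ι, f 0 = f m → 0 ≤ ∑ t ∈ Finset.range m, w (f t) (f (t + 1)) := by
  classical
  induction m using Nat.strong_induction_on with
  | _ m ih =>
  intro f hf
  by_cases hinj : Set.InjOn f (Finset.range m)
  · have hnodup : ((List.range m).map f).Nodup := by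
      refine List.Nodup.map_on (fun x hx y hy hxy => hinj ?_ ?_ hxy) List.nodup_range
      · simpa using hx
      · simpa using hy
    set σ := ((List.range m).map f).formPerm with hσ
    have hstep : ∀ t ∈ Finset.range m, σ (f t) = f (t + 1) := by
      intro t ht
      rw [Finset.mem_range] at ht
      have h := List.formPerm_apply_getElem _ hnodup t (by simpa using ht)
      simp only [List.getElem_map, List.getElem_range, List.length_map, List.length_range] at h
      rw [hσ, h]
      rcases Nat.lt_or_ge (t + 1) m with h1 | h1
      · rw [Nat.mod_eq_of_lt h1]
      · have : t + 1 = m := by omega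
        rw [this, Nat.mod_self, hf]
    calc 0 ≤ ∑ i, w i (σ i) := hperm σ
      _ = ∑ i ∈ (Finset.range m).image f, w i (σ i) := by
        symm
        apply Finset.sum_subset (Finset.subset_univ _)
        intro i _ hi
        rw [hσ, List.formPerm_apply_of_notMem (by simpa using hi), hdiag]
      _ = ∑ t ∈ Finset.range m, w (f t) (σ (f t)) := Finset.sum_image hinj
      _ = _ := Finset.sum_congr rfl fun t ht => by rw [hstep t ht]
  · obtain ⟨s, d, e, hd, he, rfl, hfs⟩ : ∃ s d e, 0 < d ∧ 0 < e ∧ m = s + d + e ∧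
        f s = f (s + d) := by
      simp only [Set.InjOn, not_forall, Finset.coe_range, Set.mem_Iio] at hinj
      obtain ⟨x, hx, y, hy, hxy, hne⟩ := hinj
      rcases lt_or_gt_of_ne hne with h | h
      · exact ⟨x, y - x, m - y, by omega, by omega, by omega,
          by rwa [Nat.add_sub_cancel' h.le]⟩
      · exact ⟨y, x - y, m - x, by omega, by omega, by omega,
          by rw [Nat.add_sub_cancel' h.le, hxy]⟩
    have hinner := ih d (by omega) (fun u => f (s + u)) (by simpa using hfs)
    let g : ℕ → ι := fun u => if u ≤ s then f u else f (u + d)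
    have hlow : ∀ u ≤ s, g u = f u := fun u hu => if_pos hu
    have hhigh : ∀ u, g (s + u) = f (s + d + u) := by
      intro u
      rcases Nat.eq_zero_or_pos u with rfl | hu
      · simpa [g] using hfs
      · simp only [g]
        rw [if_neg (by omega)]
        congr 1
        omega
    have houter := ih (s + e) (by omega) g (by rw [hlow 0 (Nat.zero_le _), hhigh, hf])
    rw [Finset.sum_range_add] at houter
    have h1 : ∑ u ∈ Finset.range s, w (g u) (g (u + 1)) =
        ∑ u ∈ Finset.range s, w (f u) (f (u + 1)) :=
      Finset.sum_congr rfl fun u hu => by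
        rw [Finset.mem_range] at hu
        rw [hlow u (by omega), hlow (u + 1) (by omega)]
    simp only [add_assoc s, hhigh, h1] at houter
    rw [Finset.sum_range_add, Finset.sum_range_add]
    simp only [add_assoc] at hinner houter ⊢
    linarith

/-- If every permutation has nonnegative total weight, then the weights dominate the differences
of a potential. -/
lemma exists_potential_of_perm_nonneg {ι : Type*} [Fintype ι] (w : ι → ι → ℝ)
    (hdiag : ∀ i, w i i = 0) (hperm : ∀ σ : Equiv.Perm ι, 0 ≤ ∑ i, w i (σ i)) :
    ∃ a : ι → ℝ, ∀ i j, a i - a j ≤ w i j := by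
  rcases isEmpty_or_nonempty ι with hι | ⟨⟨r⟩⟩
  · exact ⟨fun _ => 0, fun i => isEmptyElim i⟩
  let S : ι → Set ℝ := fun i => {c | ∃ (m : ℕ) (f : ℕ → ι), f 0 = i ∧ f m = r ∧
    c = ∑ t ∈ Finset.range m, w (f t) (f (t + 1))}
  have hcons : ∀ i j, ∀ c ∈ S j, w i j + c ∈ S i := by
    rintro i j _ ⟨m, f, rfl, hr, rfl⟩
    refine ⟨m + 1, fun u => Nat.casesOn u i f, rfl, hr, ?_⟩
    rw [Finset.sum_range_succ', add_comm]
    rfl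
  have hbdd : ∀ i, BddBelow (S i) := by
    refine fun i => ⟨-w r i, fun c hc => ?_⟩
    obtain ⟨m, f, h0, hm, hc⟩ := hcons r i c hc
    have := closedWalk_nonneg_of_perm_nonneg w hdiag hperm m f (h0.trans hm.symm)
    linarith
  have hne : ∀ i, (S i).Nonempty := fun i =>
    ⟨_, hcons i r 0 ⟨0, fun _ => r, rfl, rfl, by simp⟩⟩
  refine ⟨fun i => sInf (S i), fun i j => ?_⟩
  have : sInf (S i) - w i j ≤ sInf (S j) := le_csInf (hne j) fun c hc => by
    have := csInf_le (hbdd i) (hcons i j c hc)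
    linarith
  linarith

/-- Existence of the 1-Lipschitz function `ζ*` on the configuration of
points realizing the length of a minimal connection (Brezis–Coron–Lieb). -/
theorem stmt0 (k : ℕ) (hk : 1 ≤ k)
    (p n : Fin k → EuclideanSpace ℝ (Fin 3))
    (hmin : ∀ σ : Equiv.Perm (Fin k),
      ∑ i, dist (p i) (n i) ≤ ∑ i, dist (p i) (n (σ i))) :
    ∃ ζ : EuclideanSpace ℝ (Fin 3) → ℝ,
      (∀ x ∈ Set.range p ∪ Set.range n, ∀ y ∈ Set.range p ∪ Set.range n,
        |ζ x - ζ y| ≤ dist x y) ∧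
      (∑ i, (ζ (p i) - ζ (n i))) = ∑ i, dist (p i) (n i) ∧
      (∀ i, ζ (n i) = ζ (p i) - dist (p i) (n i)) := by
  obtain ⟨a, ha⟩ := exists_potential_of_perm_nonneg
    (fun i j => dist (p i) (n j) - dist (p j) (n j)) (fun i => sub_self _) (fun σ => by
      rw [Finset.sum_sub_distrib, Equiv.sum_comp σ (fun j => dist (p j) (n j))]
      exact sub_nonneg.2 (hmin σ))
  have : Nonempty (Fin k) := ⟨⟨0, hk⟩⟩
  let ζ : EuclideanSpace ℝ (Fin 3) → ℝ := fun x => ⨅ j, (a j - dist (p j) (n j) + dist x (n j))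
  have hle : ∀ x j, ζ x ≤ a j - dist (p j) (n j) + dist x (n j) := fun x j =>
    ciInf_le (Set.finite_range _).bddBelow j
  have hsub : ∀ x y, ζ x - ζ y ≤ dist x y := by
    intro x y
    have : ζ x - dist x y ≤ ζ y := le_ciInf fun j => by
      linarith [hle x j, dist_triangle x y (n j)]
    linarith
  have hlow : ∀ i, a i ≤ ζ (p i) := fun i => le_ciInf fun j => by linarith [ha i j]
  have hval : ∀ i, ζ (n i) = ζ (p i) - dist (p i) (n i) := by
    intro i
    have h1 := hle (n i) i
    rw [dist_self] at h1
    linarith [hlow i, hsub (p i) (n i)]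
  refine ⟨ζ, fun x _ y _ => abs_sub_le_iff.2 ⟨hsub x y, ?_⟩, ?_, hval⟩
  · rw [dist_comm]
    exact hsub y x
  · exact Finset.sum_congr rfl fun i _ => by rw [hval i]; ring
end

section
/- Let Ω ⊂ ℝ³ be a bounded open set with nonempty boundary, let k ≥ 1, and let p_1,…,p_k, n_1,…,n_k ∈ Ω be a configuration of points. Assume, after relabeling, that L_{∂Ω}(𝒜) = Σ_{i=1}^k d_{∂Ω}(p_i, n_i). Then there exists a function ζ* defined on the finite set {p_1,…,p_k, n_1,…,n_k} with values in ℝ which is 1-Lipschitz for the distance d_{∂Ω} (i.e. |ζ*(x) − ζ*(y)| ≤ d_{∂Ω}(x,y) for all x, y in this set) such that Σ_{i=1}^k (ζ*(p_i) − ζ*(n_i)) = L_{∂Ω}(𝒜) and ζ*(n_i) = ζ*(p_i) − d_{∂Ω}(p_i, n_i) for every i ∈ {1,…,k}. -/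
open scoped BigOperators

/-- If every permutation has nonnegative total cost, then so has every closed walk: its matrix of step
counts, completed on the diagonal, is a multiple of a doubly stochastic matrix. -/
theorem closedWalk_cost_nonneg {ι : Type*} [Fintype ι] [DecidableEq ι] (w : ι → ι → ℝ)
    (hdiag : ∀ i, w i i = 0) (hperm : ∀ σ : Equiv.Perm ι, 0 ≤ ∑ i, w i (σ i))
    (m : ℕ) (g : ℕ → ι) :
    0 ≤ (∑ l ∈ Finset.range m, w (g l) (g (l + 1))) + w (g m) (g 0) := by
  let visits : ι → ℝ := fun a => ∑ l ∈ Finset.range (m + 1), if g l = a then 1 else 0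
  let steps : Matrix ι ι ℝ := fun a b =>
    (∑ l ∈ Finset.range m, if g l = a ∧ g (l + 1) = b then 1 else 0) +
      if g m = a ∧ g 0 = b then 1 else 0
  have hm : (0 : ℝ) < m + 1 := by positivity
  have hsteps (a b : ι) : 0 ≤ steps a b :=
    add_nonneg (Finset.sum_nonneg fun l _ => by split_ifs <;> norm_num)
      (by split_ifs <;> norm_num)
  have hrow (a : ι) : ∑ b, steps a b = visits a := by
    simp only [steps, visits, Finset.sum_add_distrib, Finset.sum_range_succ]
    rw [Finset.sum_comm]
    simp [ite_and]
  have hcol (b : ι) : ∑ a, steps a b = visits b := by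
    simp only [steps, visits, Finset.sum_add_distrib, Finset.sum_range_succ']
    rw [Finset.sum_comm]
    simp [ite_and]
  have hvisits (a : ι) : visits a ≤ m + 1 := by
    calc visits a ≤ ∑ l ∈ Finset.range (m + 1), (1 : ℝ) :=
          Finset.sum_le_sum fun l _ => by split_ifs <;> norm_num
      _ = m + 1 := by simp
  let M : Matrix ι ι ℝ := fun a b =>
    (m + 1 : ℝ)⁻¹ * (steps a b + if a = b then (m + 1 : ℝ) - visits a else 0)
  have hM : M ∈ doublyStochastic ℝ ι := by
    rw [mem_doublyStochastic_iff_sum]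
    refine ⟨fun a b => ?_, fun a => ?_, fun b => ?_⟩
    · refine mul_nonneg (by positivity) (add_nonneg (hsteps a b) ?_)
      split_ifs
      · linarith [hvisits a]
      · exact le_rfl
    · simp only [M, ← Finset.mul_sum, Finset.sum_add_distrib, hrow]
      simp [hm.ne']
    · simp only [M, ← Finset.mul_sum, Finset.sum_add_distrib, hcol]
      simp [hm.ne']
  obtain ⟨c, hc, -, hcM⟩ := exists_eq_sum_perm_of_mem_doublyStochastic hM
  have hnonneg : 0 ≤ ∑ a, ∑ b, M a b * w a b := by
    have hσ (σ : Equiv.Perm ι) :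
        ∑ a, ∑ b, σ.permMatrix ℝ a b * w a b = ∑ a, w a (σ a) := by
      simp [Equiv.Perm.permMatrix, PEquiv.toMatrix_apply]
    have heq : ∑ a, ∑ b, M a b * w a b = ∑ σ, c σ * ∑ a, w a (σ a) := by
      simp_rw [← hcM, Matrix.sum_apply, Matrix.smul_apply, smul_eq_mul, Finset.sum_mul, ← hσ,
        Finset.mul_sum, mul_assoc]
      rw [Finset.sum_comm_cycle]
    rw [heq]
    exact Finset.sum_nonneg fun σ _ => mul_nonneg (hc σ) (hperm σ)
  have hMw : ∑ a, ∑ b, M a b * w a b = (m + 1 : ℝ)⁻¹ *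
      ((∑ l ∈ Finset.range m, w (g l) (g (l + 1))) + w (g m) (g 0)) := by
    have hpair (i j : ι) :
        ∑ a, ∑ b, (if i = a ∧ j = b then (1 : ℝ) else 0) * w a b = w i j := by
      simp [ite_and]
    have hdiagTerm (a : ι) :
        ∑ b, (if a = b then (m + 1 : ℝ) - visits a else 0) * w a b = 0 := by
      simp [hdiag]
    simp only [M, steps, mul_assoc, ← Finset.mul_sum, add_mul, Finset.sum_add_distrib, hdiagTerm,
      hpair, Finset.sum_mul, add_zero]
    congr 2
    rw [Finset.sum_comm_cycle]
    exact Finset.sum_congr rfl fun l _ => hpair _ _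
  rw [hMw] at hnonneg
  exact nonneg_of_mul_nonneg_right hnonneg (by positivity)

/-- Costs whose sum along every permutation is nonnegative admit a potential. -/
theorem exists_potential {ι : Type*} [Fintype ι] (w : ι → ι → ℝ)
    (hdiag : ∀ i, w i i = 0) (hperm : ∀ σ : Equiv.Perm ι, 0 ≤ ∑ i, w i (σ i)) :
    ∃ u : ι → ℝ, ∀ i j, u i ≤ w i j + u j := by
  classical
  let walks : ι → Type _ := fun i => {q : ℕ × (ℕ → ι) // q.2 0 = i}
  let cost : ∀ i, walks i → ℝ := fun i q =>
    ∑ l ∈ Finset.range q.1.1, w (q.1.2 l) (q.1.2 (l + 1))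
  have hbdd (i : ι) : BddBelow (Set.range (cost i)) := by
    obtain ⟨C, hC⟩ := (Set.finite_range fun a => w a i).bddAbove
    refine ⟨-C, ?_⟩
    rintro _ ⟨⟨⟨m, g⟩, hg : g 0 = i⟩, rfl⟩
    have h1 := closedWalk_cost_nonneg w hdiag hperm m g
    have h2 : w (g m) (g 0) ≤ C := hg ▸ hC ⟨g m, rfl⟩
    change -C ≤ ∑ l ∈ Finset.range m, w (g l) (g (l + 1))
    linarith
  refine ⟨fun i => ⨅ q, cost i q, fun i j => ?_⟩
  have : Nonempty (walks j) := ⟨⟨(0, fun _ => j), rfl⟩⟩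
  rw [← sub_le_iff_le_add']
  refine le_ciInf ?_
  rintro ⟨⟨m, g⟩, hg : g 0 = j⟩
  have h := ciInf_le (hbdd i) ⟨(m + 1, fun l => Nat.casesOn l i g), rfl⟩
  have hcost : cost i ⟨(m + 1, fun l => Nat.casesOn l i g), rfl⟩ =
      (∑ l ∈ Finset.range m, w (g l) (g (l + 1))) + w i (g 0) :=
    Finset.sum_range_succ' _ _
  rw [hcost, hg] at h
  change _ ≤ ∑ l ∈ Finset.range m, w (g l) (g (l + 1))
  linarith

/-- Kantorovich duality for an optimal assignment with respect to a pseudometric `d`. -/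
theorem exists_lipschitz_of_optimal_assignment {X ι : Type*} [Fintype ι] [Nonempty ι]
    (d : X → X → ℝ) (hself : ∀ x, d x x = 0) (hsymm : ∀ x y, d x y = d y x)
    (htri : ∀ x y z, d x z ≤ d x y + d y z) (p n : ι → X)
    (hmin : ∀ σ : Equiv.Perm ι, ∑ i, d (p i) (n i) ≤ ∑ i, d (p i) (n (σ i))) :
    ∃ ζ : X → ℝ, (∀ x y, |ζ x - ζ y| ≤ d x y) ∧
      ∀ i, ζ (n i) = ζ (p i) - d (p i) (n i) := by
  obtain ⟨u, hu⟩ := exists_potential (fun i j => d (p i) (n j) - d (p j) (n j))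
    (fun i => sub_self _) fun σ => by
      rw [Finset.sum_sub_distrib, Equiv.sum_comp σ fun i => d (p i) (n i)]
      exact sub_nonneg.2 (hmin σ)
  let ζ : X → ℝ := fun x => ⨅ j, (u j - d (p j) (n j) + d x (n j))
  have hle (x : X) (j : ι) : ζ x ≤ u j - d (p j) (n j) + d x (n j) :=
    ciInf_le (Set.finite_range _).bddBelow j
  have hlip (x y : X) : ζ x - d x y ≤ ζ y :=
    le_ciInf fun j => by linarith [hle x j, htri x y (n j)]
  have hp (i : ι) : u i ≤ ζ (p i) := le_ciInf fun j => by linarith [hu i j]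
  refine ⟨ζ, fun x y => abs_sub_le_iff.2 ⟨?_, ?_⟩, fun i => le_antisymm ?_ ?_⟩
  · linarith [hlip x y]
  · linarith [hlip y x, hsymm x y]
  · linarith [hle (n i) i, hself (n i), hp i]
  · exact hlip (p i) (n i)

/-- Existence of the function `ζ*`, 1-Lipschitz for the distance
`d_{∂Ω}`, realizing the length of a minimal connection through the boundary. -/
theorem stmt2 (Ω : Set (EuclideanSpace ℝ (Fin 3)))
    (hΩo : IsOpen Ω) (hΩb : Bornology.IsBounded Ω) (hfr : (frontier Ω).Nonempty)
    (k : ℕ) (hk : 1 ≤ k)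
    (p n : Fin k → EuclideanSpace ℝ (Fin 3))
    (hp : ∀ i, p i ∈ Ω) (hn : ∀ i, n i ∈ Ω)
    -- the distance through the boundary `d_{∂Ω}`
    (dΩ : EuclideanSpace ℝ (Fin 3) → EuclideanSpace ℝ (Fin 3) → ℝ)
    (hdΩ : ∀ x y, dΩ x y =
      min (dist x y) (Metric.infDist x (frontier Ω) + Metric.infDist y (frontier Ω)))
    -- after relabeling, the identity permutation achieves `L_{∂Ω}(𝒜)`
    (hmin : ∀ σ : Equiv.Perm (Fin k),
      ∑ i, dΩ (p i) (n i) ≤ ∑ i, dΩ (p i) (n (σ i))) :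
    ∃ ζ : EuclideanSpace ℝ (Fin 3) → ℝ,
      (∀ x ∈ Set.range p ∪ Set.range n, ∀ y ∈ Set.range p ∪ Set.range n,
        |ζ x - ζ y| ≤ dΩ x y) ∧
      (∑ i, (ζ (p i) - ζ (n i))) = ∑ i, dΩ (p i) (n i) ∧
      (∀ i, ζ (n i) = ζ (p i) - dΩ (p i) (n i)) := by
  have : Nonempty (Fin k) := ⟨⟨0, hk⟩⟩
  have hb (x y : EuclideanSpace ℝ (Fin 3)) :
      Metric.infDist x (frontier Ω) ≤ Metric.infDist y (frontier Ω) + dist x y :=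
    Metric.infDist_le_infDist_add_dist
  have hb0 (x : EuclideanSpace ℝ (Fin 3)) : 0 ≤ Metric.infDist x (frontier Ω) :=
    Metric.infDist_nonneg
  obtain ⟨ζ, hlip, hζ⟩ := exists_lipschitz_of_optimal_assignment dΩ
    (fun x => by
      rw [hdΩ, dist_self]
      exact min_eq_left (add_nonneg (hb0 x) (hb0 x)))
    (fun x y => by rw [hdΩ, hdΩ, dist_comm, add_comm])
    (fun x y z => by
      rw [hdΩ, hdΩ, hdΩ]
      have h1 := hb x y
      have h2 := hb z y
      rw [dist_comm z y] at h2
      have h3 := hb0 y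
      have h4 := dist_triangle x y z
      rcases min_cases (dist x y) (Metric.infDist x (frontier Ω) + Metric.infDist y (frontier Ω))
        with ⟨e, -⟩ | ⟨e, -⟩ <;>
      rcases min_cases (dist y z) (Metric.infDist y (frontier Ω) + Metric.infDist z (frontier Ω))
        with ⟨e', -⟩ | ⟨e', -⟩ <;>
      rw [e, e', min_le_iff]
      · exact Or.inl h4
      all_goals right; linarith)
    p n hmin
  exact ⟨ζ, fun x _ y _ => hlip x y, Finset.sum_congr rfl fun i _ => by rw [hζ i]; ring, hζ⟩
end

section
/- There exists a constant θ₁ > 0 with the following property. For any four points x_1, x_2, x_3, x_4 ∈ ℝ³ with x_1 ≠ x_2, any number D ≥ max_{1≤i<j≤4} |x_i − x_j|, and any 0 < θ < θ₁, there exists a point x_4' ∈ ℝ³ with x_4' ≠ x_3 such that | ((x_2 − x_1)/|x_2 − x_1|) × ((x_4' − x_3)/|x_4' − x_3|) | ≥ θ, |x_4 − x_4'| ≤ 3Dθ, and max_{1≤i≤3} |x_i − x_4'| ≤ D. The constant θ₁ is independent of the points and of D. -/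
noncomputable section

/-- The cross product of two vectors of `ℝ³` (as Euclidean space). -/
def cross3 (u v : EuclideanSpace ℝ (Fin 3)) : EuclideanSpace ℝ (Fin 3) :=
  (WithLp.equiv 2 (Fin 3 → ℝ)).symm
    ![u 1 * v 2 - u 2 * v 1, u 2 * v 0 - u 0 * v 2, u 0 * v 1 - u 1 * v 0]

open scoped RealInnerProductSpace

/-- Lagrange's identity for the cross product. -/
lemma norm_cross3_sq (u v : EuclideanSpace ℝ (Fin 3)) :
    ‖cross3 u v‖ ^ 2 = ‖u‖ ^ 2 * ‖v‖ ^ 2 - ⟪u, v⟫ ^ 2 := by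
  simp only [EuclideanSpace.real_norm_sq_eq, PiLp.inner_apply, Fin.sum_univ_three]
  simp [cross3]
  ring

lemma cross3_smul_right (u v : EuclideanSpace ℝ (Fin 3)) (a : ℝ) :
    cross3 u (a • v) = a • cross3 u v := by
  ext i
  fin_cases i <;> simp [cross3] <;> ring

/-- The component of `v` along a unit vector orthogonal to the unit vector `e` is at most the
distance from `v` to the line spanned by `e`. -/
lemma inner_le_norm_cross3 {e n : EuclideanSpace ℝ (Fin 3)} (he : ‖e‖ = 1) (hn : ‖n‖ = 1)
    (hne : ⟪n, e⟫ = 0) (v : EuclideanSpace ℝ (Fin 3)) : ⟪n, v⟫ ≤ ‖cross3 e v‖ := by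
  have h1 : ⟪n, v - ⟪e, v⟫ • e⟫ = ⟪n, v⟫ := by
    rw [inner_sub_right, inner_smul_right, hne, mul_zero, sub_zero]
  have h2 : ‖v - ⟪e, v⟫ • e‖ ^ 2 = ‖cross3 e v‖ ^ 2 := by
    rw [norm_cross3_sq, norm_sub_sq_real, inner_smul_right, norm_smul, he,
      real_inner_comm e v, Real.norm_eq_abs, mul_one, sq_abs]
    ring
  rw [← h1, ← (sq_eq_sq₀ (norm_nonneg _) (norm_nonneg _)).1 h2]
  simpa [hn] using real_inner_le_norm n (v - ⟪e, v⟫ • e)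

/-- In `ℝ³` there is a unit vector orthogonal to two given vectors, lying in a given closed
half-space. -/
lemma exists_unit_orthogonal (a b v : EuclideanSpace ℝ (Fin 3)) :
    ∃ n : EuclideanSpace ℝ (Fin 3), ‖n‖ = 1 ∧ ⟪n, a⟫ = 0 ∧ ⟪n, b⟫ = 0 ∧ 0 ≤ ⟪n, v⟫ := by
  classical
  set K : Submodule ℝ (EuclideanSpace ℝ (Fin 3)) :=
    Submodule.span ℝ (({a, b} : Finset (EuclideanSpace ℝ (Fin 3))) : Set _) with hK
  have hfin : Module.finrank ℝ K ≤ 2 :=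
    (finrank_span_finset_le_card _).trans Finset.card_le_two
  have hsum := K.finrank_add_finrank_orthogonal
  rw [finrank_euclideanSpace_fin] at hsum
  have hne : Kᗮ ≠ ⊥ := by
    intro h
    rw [h, finrank_bot] at hsum
    omega
  obtain ⟨m, hm, hm0⟩ := Submodule.exists_mem_ne_zero_of_ne_bot hne
  have ha : ⟪m, a⟫ = 0 :=
    Submodule.inner_left_of_mem_orthogonal (Submodule.subset_span (by simp)) hm
  have hb : ⟪m, b⟫ = 0 :=
    Submodule.inner_left_of_mem_orthogonal (Submodule.subset_span (by simp)) hm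
  have hm1 : ‖‖m‖⁻¹ • m‖ = 1 := by
    rw [norm_smul, norm_inv, norm_norm, inv_mul_cancel₀ (norm_ne_zero_iff.2 hm0)]
  rcases le_total 0 ⟪‖m‖⁻¹ • m, v⟫ with h | h
  · exact ⟨‖m‖⁻¹ • m, hm1, by simp [inner_smul_left, ha], by simp [inner_smul_left, hb], h⟩
  · refine ⟨-(‖m‖⁻¹ • m), by rwa [norm_neg], by simp [inner_smul_left, ha],
      by simp [inner_smul_left, hb], ?_⟩
    rw [inner_neg_left]
    linarith

/-- A unit-vector perturbation by `2 * D * θ` that is nearly orthogonal to `v` lengthens `v`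
only to second order in `θ`. -/
lemma norm_add_smul_le {E : Type*} [NormedAddCommGroup E] [InnerProductSpace ℝ E]
    {v n : E} {D θ : ℝ} (hD : 0 ≤ D) (hθ : 0 ≤ θ) (hn : ‖n‖ = 1) (hv : ‖v‖ ≤ D)
    (hnv : ⟪n, v⟫ ≤ θ * D) : ‖v + (2 * θ * D) • n‖ ≤ (1 + 4 * θ ^ 2) * D := by
  refine le_of_sq_le_sq ?_ (by positivity)
  rw [norm_add_sq_real, inner_smul_right, norm_smul, hn, real_inner_comm, mul_one,
    Real.norm_eq_abs, sq_abs]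
  have h1 : ‖v‖ ^ 2 ≤ D ^ 2 := pow_le_pow_left₀ (norm_nonneg _) hv 2
  have h2 : 2 * θ * D * ⟪n, v⟫ ≤ 2 * θ * D * (θ * D) :=
    mul_le_mul_of_nonneg_left hnv (by positivity)
  have h3 : 0 ≤ (θ ^ 2 * D) ^ 2 := sq_nonneg _
  nlinarith

/-- If `w` is at most slightly longer than `D`, then moving it towards a vector of norm at most
`2 * D / 3` brings it back into the ball of radius `D`. -/
lemma norm_convexCombination_le {E : Type*} [NormedAddCommGroup E] [NormedSpace ℝ E]
    {w c : E} {D θ : ℝ} (hD : 0 ≤ D) (hθ : 12 * θ ^ 2 ≤ 1)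
    (hw : ‖w‖ ≤ (1 + 4 * θ ^ 2) * D) (hc : ‖c‖ ≤ 2 / 3 * D) :
    ‖(1 - 12 * θ ^ 2) • w + (12 * θ ^ 2) • c‖ ≤ D := by
  refine (norm_add_le _ _).trans ?_
  rw [norm_smul, norm_smul, Real.norm_of_nonneg (by linarith : 0 ≤ 1 - 12 * θ ^ 2),
    Real.norm_of_nonneg (by positivity : 0 ≤ 12 * θ ^ 2)]
  have h1 := mul_le_mul_of_nonneg_left hw (by linarith : 0 ≤ 1 - 12 * θ ^ 2)
  have h2 := mul_le_mul_of_nonneg_left hc (by positivity : 0 ≤ 12 * θ ^ 2)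
  have h3 : 0 ≤ θ ^ 2 * θ ^ 2 * D := by positivity
  nlinarith

lemma norm_third_smul_add_le {E : Type*} [NormedAddCommGroup E] [NormedSpace ℝ E]
    (a b c : E) : ‖(1 / 3 : ℝ) • (a + b + c)‖ ≤ (‖a‖ + ‖b‖ + ‖c‖) / 3 := by
  rw [norm_smul, Real.norm_of_nonneg (by norm_num)]
  linarith [norm_add₃_le (a := a) (b := b) (c := c)]

/-- A point at distance at least `θ * D` from the line through `0` in direction `e`, in the ball
of radius `D`, makes an angle of sine at least `θ` with `e`. -/
lemma le_norm_cross3_normalized {e v : EuclideanSpace ℝ (Fin 3)} {D θ : ℝ} (hD : 0 < D)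
    (hθ : 0 < θ) (hv : ‖v‖ ≤ D) (h : θ * D ≤ ‖cross3 e v‖) :
    v ≠ 0 ∧ θ ≤ ‖cross3 e (‖v‖⁻¹ • v)‖ := by
  have hv0 : v ≠ 0 := by
    rintro rfl
    have h0 : cross3 e 0 = 0 := by simpa using cross3_smul_right e 0 0
    rw [h0, norm_zero] at h
    exact absurd h (not_le.2 (mul_pos hθ hD))
  have hpos : 0 < ‖v‖ := norm_pos_iff.2 hv0
  refine ⟨hv0, ?_⟩
  rw [cross3_smul_right, norm_smul, norm_inv, norm_norm, inv_mul_eq_div, le_div_iff₀ hpos]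
  exact (mul_le_mul_of_nonneg_left hv hθ.le).trans h

/-- Displacement of one point of a dipole so that the corresponding unit
vectors form a quantitatively nonzero angle. -/
theorem stmt4 :
    ∃ θ₁ : ℝ, 0 < θ₁ ∧
      ∀ x₁ x₂ x₃ x₄ : EuclideanSpace ℝ (Fin 3), x₁ ≠ x₂ →
      ∀ D : ℝ,
        (∀ y ∈ ({x₁, x₂, x₃, x₄} : Set (EuclideanSpace ℝ (Fin 3))),
          ∀ z ∈ ({x₁, x₂, x₃, x₄} : Set (EuclideanSpace ℝ (Fin 3))), dist y z ≤ D) →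
      ∀ θ : ℝ, 0 < θ → θ < θ₁ →
      ∃ x₄' : EuclideanSpace ℝ (Fin 3), x₄' ≠ x₃ ∧
        θ ≤ ‖cross3 (‖x₂ - x₁‖⁻¹ • (x₂ - x₁)) (‖x₄' - x₃‖⁻¹ • (x₄' - x₃))‖ ∧
        dist x₄ x₄' ≤ 3 * D * θ ∧
        dist x₁ x₄' ≤ D ∧ dist x₂ x₄' ≤ D ∧ dist x₃ x₄' ≤ D := by
  refine ⟨1 / 20, by norm_num, ?_⟩
  intro x₁ x₂ x₃ x₄ hne D hdist θ hθ hθ₁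
  have h12 : ‖x₂ - x₁‖ ≤ D := by rw [← dist_eq_norm]; exact hdist _ (by simp) _ (by simp)
  have h13 : ‖x₁ - x₃‖ ≤ D := by rw [← dist_eq_norm]; exact hdist _ (by simp) _ (by simp)
  have h23 : ‖x₂ - x₃‖ ≤ D := by rw [← dist_eq_norm]; exact hdist _ (by simp) _ (by simp)
  have h41 : ‖x₄ - x₁‖ ≤ D := by rw [← dist_eq_norm]; exact hdist _ (by simp) _ (by simp)
  have h42 : ‖x₄ - x₂‖ ≤ D := by rw [← dist_eq_norm]; exact hdist _ (by simp) _ (by simp)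
  have h43 : ‖x₄ - x₃‖ ≤ D := by rw [← dist_eq_norm]; exact hdist _ (by simp) _ (by simp)
  have hpos : 0 < ‖x₂ - x₁‖ := norm_pos_iff.2 (sub_ne_zero.2 hne.symm)
  have hD : 0 < D := hpos.trans_le h12
  set e := ‖x₂ - x₁‖⁻¹ • (x₂ - x₁) with he_def
  have he : ‖e‖ = 1 := by
    rw [he_def, norm_smul, norm_inv, norm_norm, inv_mul_cancel₀ hpos.ne']
  rcases le_or_gt (θ * D) ‖cross3 e (x₄ - x₃)‖ with hfar | hnear
  · obtain ⟨h0, hle⟩ := le_norm_cross3_normalized hD hθ h43 hfar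
    refine ⟨x₄, sub_ne_zero.1 h0, hle, ?_, ?_, ?_, ?_⟩
    · rw [dist_self]; positivity
    all_goals rwa [dist_comm, dist_eq_norm]
  obtain ⟨n, hn, hn12, hn41, hn43⟩ :=
    exists_unit_orthogonal (x₂ - x₁) (x₄ - x₁) (x₄ - x₃)
  have hn42 : ⟪n, x₄ - x₂⟫ = 0 := by
    rw [← sub_sub_sub_cancel_right x₄ x₂ x₁, inner_sub_right, hn41, hn12, sub_zero]
  have hne : ⟪n, e⟫ = 0 := by rw [he_def, inner_smul_right, hn12, mul_zero]
  have hn43' : ⟪n, x₄ - x₃⟫ ≤ θ * D := (inner_le_norm_cross3 he hn hne _).trans hnear.le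
  have hθD : 0 < θ * D := mul_pos hθ hD
  have ht : 12 * θ ^ 2 ≤ 1 := by nlinarith
  set c := (1 / 3 : ℝ) • (x₁ + x₂ + x₃) with hc
  set y := (1 - 12 * θ ^ 2) • (x₄ + (2 * θ * D) • n) + (12 * θ ^ 2) • c with hy
  have hyx (x : EuclideanSpace ℝ (Fin 3)) : y - x =
      (1 - 12 * θ ^ 2) • (x₄ - x + (2 * θ * D) • n) + (12 * θ ^ 2) • (c - x) := by
    rw [hy]; module
  have hc1 : ‖c - x₁‖ ≤ 2 / 3 * D := by
    have h : c - x₁ = (1 / 3 : ℝ) • ((x₂ - x₁) + (x₃ - x₁) + 0) := by rw [hc]; module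
    rw [h]
    refine (norm_third_smul_add_le _ _ _).trans ?_
    rw [norm_sub_rev x₃, norm_zero]
    linarith
  have hc2 : ‖c - x₂‖ ≤ 2 / 3 * D := by
    have h : c - x₂ = (1 / 3 : ℝ) • ((x₁ - x₂) + (x₃ - x₂) + 0) := by rw [hc]; module
    rw [h]
    refine (norm_third_smul_add_le _ _ _).trans ?_
    rw [norm_sub_rev x₃, norm_sub_rev x₁, norm_zero]
    linarith
  have hc3 : ‖c - x₃‖ ≤ 2 / 3 * D := by
    have h : c - x₃ = (1 / 3 : ℝ) • ((x₁ - x₃) + (x₂ - x₃) + 0) := by rw [hc]; module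
    rw [h]
    refine (norm_third_smul_add_le _ _ _).trans ?_
    rw [norm_zero]
    linarith
  have hc4 : ‖c - x₄‖ ≤ D := by
    have h : c - x₄ = (1 / 3 : ℝ) • ((x₁ - x₄) + (x₂ - x₄) + (x₃ - x₄)) := by rw [hc]; module
    rw [h]
    refine (norm_third_smul_add_le _ _ _).trans ?_
    rw [norm_sub_rev x₁, norm_sub_rev x₂, norm_sub_rev x₃]
    linarith
  have hy1 : ‖y - x₁‖ ≤ D := by
    rw [hyx]
    exact norm_convexCombination_le hD.le ht
      (norm_add_smul_le hD.le hθ.le hn h41 (hn41.trans_le hθD.le)) hc1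
  have hy2 : ‖y - x₂‖ ≤ D := by
    rw [hyx]
    exact norm_convexCombination_le hD.le ht
      (norm_add_smul_le hD.le hθ.le hn h42 (hn42.trans_le hθD.le)) hc2
  have hy3 : ‖y - x₃‖ ≤ D := by
    rw [hyx]
    exact norm_convexCombination_le hD.le ht
      (norm_add_smul_le hD.le hθ.le hn h43 hn43') hc3
  have hθsq : θ ^ 2 * D ≤ 1 / 20 * (θ * D) := by nlinarith
  have hθcube : θ ^ 2 * (θ * D) ≤ 1 / 400 * (θ * D) :=
    mul_le_mul_of_nonneg_right (by nlinarith) hθD.le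
  have hyn : θ * D ≤ ⟪n, y - x₃⟫ := by
    have hcn : -(2 / 3 * D) ≤ ⟪n, c - x₃⟫ := by
      have h := (abs_le.1 (abs_real_inner_le_norm n (c - x₃))).1
      rw [hn, one_mul] at h
      linarith
    rw [hyx, inner_add_right, inner_smul_right, inner_smul_right, inner_add_right,
      inner_smul_right, real_inner_self_eq_norm_sq, hn]
    have h1 := mul_nonneg (by linarith : 0 ≤ 1 - 12 * θ ^ 2) hn43
    have h2 := mul_le_mul_of_nonneg_left hcn (by positivity : 0 ≤ 12 * θ ^ 2)
    linarith
  obtain ⟨h0, hle⟩ := le_norm_cross3_normalized hD hθ hy3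
    (hyn.trans (inner_le_norm_cross3 he hn hne _))
  refine ⟨y, sub_ne_zero.1 h0, hle, ?_, ?_, ?_, ?_⟩
  · rw [dist_comm, dist_eq_norm, hyx, sub_self, zero_add]
    refine (norm_add_le _ _).trans ?_
    rw [norm_smul, norm_smul, norm_smul, hn,
      Real.norm_of_nonneg (by linarith : 0 ≤ 1 - 12 * θ ^ 2),
      Real.norm_of_nonneg (by positivity : 0 ≤ 12 * θ ^ 2),
      Real.norm_of_nonneg (by positivity : 0 ≤ 2 * θ * D)]
    have h2 := mul_le_mul_of_nonneg_left hc4 (by positivity : 0 ≤ 12 * θ ^ 2)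
    have h3 : 0 ≤ θ ^ 2 * (θ * D) := by positivity
    linarith
  all_goals rwa [dist_comm, dist_eq_norm]
end
end

section
/- Let Ω ⊂ ℝ³ be a bounded open set with nonempty boundary, let k ≥ 1, and let p_1,…,p_k, n_1,…,n_k and p_1',…,p_k', n_1',…,n_k' be two configurations of points in Ω. Then |L_{∂Ω}(𝒜) − L_{∂Ω}(𝒜')| ≤ Σ_{i=1}^k d_{∂Ω}(p_i, p_i') + Σ_{i=1}^k d_{∂Ω}(n_i, n_i') ≤ Σ_{i=1}^k |p_i − p_i'| + Σ_{i=1}^k |n_i − n_i'|. -/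
open scoped BigOperators

/-- The distance through a set `s` satisfies the triangle inequality. -/
theorem min_dist_infDist_add_triangle {α : Type*} [PseudoMetricSpace α] (s : Set α) (x y z : α) :
    min (dist x z) (Metric.infDist x s + Metric.infDist z s) ≤
      min (dist x y) (Metric.infDist x s + Metric.infDist y s) +
        min (dist y z) (Metric.infDist y s + Metric.infDist z s) := by
  have hxyz := dist_triangle x y z
  have hxy : Metric.infDist x s ≤ Metric.infDist y s + dist x y :=
    Metric.infDist_le_infDist_add_dist
  have hzy : Metric.infDist z s ≤ Metric.infDist y s + dist z y :=
    Metric.infDist_le_infDist_add_dist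
  have hy : 0 ≤ Metric.infDist y s := Metric.infDist_nonneg
  rw [dist_comm z y] at hzy
  rcases min_cases (dist x y) (Metric.infDist x s + Metric.infDist y s) with h | h <;>
  rcases min_cases (dist y z) (Metric.infDist y s + Metric.infDist z s) with h' | h' <;>
  rw [h.1, h'.1, min_le_iff] <;>
  first
  | exact Or.inl (by linarith)
  | exact Or.inr (by linarith)

/-- Moving the points of both families changes the cost of an optimal matching by at most the
total displacement. -/
theorem isLeast_matching_le_add {α ι : Type*} [Fintype ι] {d : α → α → ℝ}
    (hsymm : ∀ x y, d x y = d y x) (htri : ∀ x y z, d x z ≤ d x y + d y z)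
    {p n p' n' : ι → α} {L L' : ℝ}
    (hL : IsLeast (Set.range fun σ : Equiv.Perm ι => ∑ i, d (p i) (n (σ i))) L)
    (hL' : IsLeast (Set.range fun σ : Equiv.Perm ι => ∑ i, d (p' i) (n' (σ i))) L') :
    L ≤ L' + (∑ i, d (p i) (p' i) + ∑ i, d (n i) (n' i)) := by
  obtain ⟨σ, rfl⟩ := hL'.1
  calc
    L ≤ ∑ i, d (p i) (n (σ i)) := hL.2 ⟨σ, rfl⟩
    _ ≤ ∑ i, (d (p' i) (n' (σ i)) + (d (p i) (p' i) + d (n (σ i)) (n' (σ i)))) := by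
      refine Finset.sum_le_sum fun i _ => ?_
      linarith [htri (p i) (p' i) (n (σ i)), htri (p' i) (n' (σ i)) (n (σ i)),
        hsymm (n (σ i)) (n' (σ i))]
    _ = _ := by
      rw [Finset.sum_add_distrib, Finset.sum_add_distrib,
        Equiv.sum_comp σ fun i => d (n i) (n' i)]

/-- Stability of the length of a minimal connection through the
boundary under displacement of the points of the configuration. -/
theorem stmt10 (Ω : Set (EuclideanSpace ℝ (Fin 3)))
    (hΩo : IsOpen Ω) (hΩb : Bornology.IsBounded Ω) (hfr : (frontier Ω).Nonempty)
    (k : ℕ) (hk : 1 ≤ k)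
    (p n p' n' : Fin k → EuclideanSpace ℝ (Fin 3))
    (hp : ∀ i, p i ∈ Ω) (hn : ∀ i, n i ∈ Ω)
    (hp' : ∀ i, p' i ∈ Ω) (hn' : ∀ i, n' i ∈ Ω)
    -- the distance through the boundary `d_{∂Ω}`
    (dΩ : EuclideanSpace ℝ (Fin 3) → EuclideanSpace ℝ (Fin 3) → ℝ)
    (hdΩ : ∀ x y, dΩ x y =
      min (dist x y) (Metric.infDist x (frontier Ω) + Metric.infDist y (frontier Ω)))
    (L L' : ℝ)
    (hL : IsLeast (Set.range fun σ : Equiv.Perm (Fin k) =>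
      ∑ i, dΩ (p i) (n (σ i))) L)
    (hL' : IsLeast (Set.range fun σ : Equiv.Perm (Fin k) =>
      ∑ i, dΩ (p' i) (n' (σ i))) L') :
    |L - L'| ≤ ∑ i, dΩ (p i) (p' i) + ∑ i, dΩ (n i) (n' i) ∧
    ∑ i, dΩ (p i) (p' i) + ∑ i, dΩ (n i) (n' i) ≤
      ∑ i, dist (p i) (p' i) + ∑ i, dist (n i) (n' i) := by
  have hsymm : ∀ x y, dΩ x y = dΩ y x := fun x y => by
    rw [hdΩ, hdΩ, dist_comm, add_comm]
  have htri : ∀ x y z, dΩ x z ≤ dΩ x y + dΩ y z := fun x y z => by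
    simpa only [hdΩ] using min_dist_infDist_add_triangle (frontier Ω) x y z
  have hle : ∀ x y, dΩ x y ≤ dist x y := fun x y => (hdΩ x y).trans_le (min_le_left _ _)
  refine ⟨?_, by gcongr <;> exact hle _ _⟩
  have h := isLeast_matching_le_add hsymm htri hL hL'
  have h' := isLeast_matching_le_add hsymm htri hL' hL
  simp only [hsymm (p' _), hsymm (n' _)] at h'
  exact abs_sub_le_iff.2 ⟨by linarith, by linarith⟩
end

section
/- Let Ω ⊂ ℝ³ be a bounded open set and let μ be a finite signed Borel measure on Ω. For γ ∈ (0,1], define ‖μ‖_γ* := sup{ ∫_Ω φ dμ : φ : Ω̄ → ℝ continuous, φ = 0 on ∂Ω, max( sup_Ω |φ|, sup_{x≠y} |φ(x) − φ(y)|/|x − y|^γ ) ≤ 1 }, and define ‖μ‖_0* := sup{ ∫_Ω φ dμ : φ : Ω̄ → ℝ continuous, φ = 0 on ∂Ω, sup_Ω |φ| ≤ 1 }. Then for every γ ∈ (0,1), ‖μ‖_γ* ≤ (‖μ‖_0*)^{1−γ} · (‖μ‖_1*)^{γ}. -/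
open MeasureTheory

noncomputable section

/-- The integral `∫_Ω φ dμ` of a function against a finite signed measure,
via the Jordan decomposition. -/
def signedIntegral (μ : SignedMeasure (EuclideanSpace ℝ (Fin 3)))
    (Ω : Set (EuclideanSpace ℝ (Fin 3))) (φ : EuclideanSpace ℝ (Fin 3) → ℝ) : ℝ :=
  (∫ x in Ω, φ x ∂μ.toJordanDecomposition.posPart)
    - (∫ x in Ω, φ x ∂μ.toJordanDecomposition.negPart)

/-- The dual Hölder norm `‖μ‖_γ*` of a finite signed measure on `Ω`:
the supremum of `∫_Ω φ dμ` over continuous `φ : Ω̄ → ℝ` vanishing on `∂Ω` with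
`max(sup|φ|, γ-Hölder seminorm) ≤ 1`. -/
def dualHolderNorm (μ : SignedMeasure (EuclideanSpace ℝ (Fin 3)))
    (Ω : Set (EuclideanSpace ℝ (Fin 3))) (γ : ℝ) : ℝ :=
  sSup { r : ℝ | ∃ φ : EuclideanSpace ℝ (Fin 3) → ℝ,
    ContinuousOn φ (closure Ω) ∧ (∀ x ∈ frontier Ω, φ x = 0) ∧
    (∀ x ∈ closure Ω, |φ x| ≤ 1) ∧
    (∀ x ∈ closure Ω, ∀ y ∈ closure Ω, x ≠ y → |φ x - φ y| ≤ dist x y ^ γ) ∧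
    r = signedIntegral μ Ω φ }

/-- The dual `C⁰` norm `‖μ‖_0*`: the supremum of `∫_Ω φ dμ` over continuous
`φ : Ω̄ → ℝ` vanishing on `∂Ω` with `sup|φ| ≤ 1`. -/
def dualC0Norm (μ : SignedMeasure (EuclideanSpace ℝ (Fin 3)))
    (Ω : Set (EuclideanSpace ℝ (Fin 3))) : ℝ :=
  sSup { r : ℝ | ∃ φ : EuclideanSpace ℝ (Fin 3) → ℝ,
    ContinuousOn φ (closure Ω) ∧ (∀ x ∈ frontier Ω, φ x = 0) ∧
    (∀ x ∈ closure Ω, |φ x| ≤ 1) ∧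
    r = signedIntegral μ Ω φ }

open scoped NNReal

/-- The lower Lipschitz envelope of a bounded function. -/
lemma exists_lipschitzWith_minorant {α : Type*} [PseudoMetricSpace α] {s : Set α}
    (hs : s.Nonempty) {φ : α → ℝ} {C δ : ℝ} (K : ℝ≥0) (hC : ∀ x ∈ s, -C ≤ φ x)
    (hφ : ∀ x ∈ s, ∀ y ∈ s, φ x - φ y ≤ δ + K * dist x y) :
    ∃ u : α → ℝ, LipschitzWith K u ∧ ∀ x ∈ s, u x ≤ φ x ∧ φ x ≤ u x + δ := by
  have : Nonempty s := hs.to_subtype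
  have hbdd (x : α) : BddBelow (Set.range fun y : s => φ y + K * dist x y) := by
    refine ⟨-C, ?_⟩
    rintro _ ⟨y, rfl⟩
    have h₁ := hC y y.2
    have h₂ : 0 ≤ K * dist x y := by positivity
    dsimp only
    linarith
  refine ⟨fun x => ⨅ y : s, (φ y + K * dist x y), ?_, fun x hx => ⟨?_, ?_⟩⟩
  · refine LipschitzWith.of_le_add_mul K fun x y => ?_
    rw [← sub_le_iff_le_add]
    refine le_ciInf fun z => ?_
    have h₁ := ciInf_le (hbdd x) z
    have h₂ : K * dist x z ≤ K * (dist x y + dist y z) := by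
      gcongr
      exact dist_triangle _ _ _
    linarith
  · simpa using ciInf_le (hbdd x) ⟨x, hx⟩
  · rw [← sub_le_iff_le_add]
    refine le_ciInf fun z => ?_
    have := hφ x hx z z.2
    linarith

/-- Uniform approximation by a bounded Lipschitz function which keeps the zeros of the
given function. -/
lemma exists_lipschitzWith_approx {α : Type*} [PseudoMetricSpace α] {s : Set α}
    {φ : α → ℝ} {δ : ℝ} (K : ℝ≥0) (hδ : 1 ≤ δ + K) (hφ₁ : ∀ x ∈ s, |φ x| ≤ 1)
    (hφ : ∀ x ∈ s, ∀ y ∈ s, φ x - φ y ≤ δ + K * dist x y) :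
    ∃ ψ : α → ℝ, LipschitzWith K ψ ∧ (∀ x, |ψ x| ≤ K) ∧ (∀ x ∈ s, |φ x - ψ x| ≤ δ) ∧
      ∀ x ∈ s, φ x = 0 → ψ x = 0 := by
  rcases s.eq_empty_or_nonempty with rfl | hs
  · exact ⟨fun _ => 0, LipschitzWith.const' 0, by simp, by simp, by simp⟩
  obtain ⟨u, hu, hu'⟩ := exists_lipschitzWith_minorant hs K
    (fun x hx => (abs_le.1 (hφ₁ x hx)).1) hφ
  obtain ⟨v, hv, hv'⟩ := exists_lipschitzWith_minorant (φ := fun x => -φ x) hs (C := 1) (δ := δ) K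
    (fun x hx => neg_le_neg (abs_le.1 (hφ₁ x hx)).2)
    (fun x hx y hy => by
      have := hφ y hy x hx
      rw [dist_comm] at this
      linarith)
  have hK : (0 : ℝ) ≤ K := K.2
  refine ⟨fun x => max (-K) (min K (max (u x) (min 0 (-v x)))), ?_, fun x => ?_,
    fun x hx => ?_, fun x hx h0 => ?_⟩
  · have h := hu.max (hv.neg.const_min 0)
    rw [max_self] at h
    exact (h.const_min K).const_max (-K)
  · rw [abs_le]
    exact ⟨le_max_left _ _, max_le (by linarith) (min_le_left _ _)⟩
  · obtain ⟨h₁, h₂⟩ := hu' x hx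
    obtain ⟨h₃, h₄⟩ := hv' x hx
    obtain ⟨h₅, h₆⟩ := abs_le.1 (hφ₁ x hx)
    rw [abs_le]
    constructor <;> grind
  · obtain ⟨h₁, h₂⟩ := hu' x hx
    obtain ⟨h₃, h₄⟩ := hv' x hx
    grind

lemma rpow_le_add_mul {γ t τ : ℝ} (hγ0 : 0 ≤ γ) (hγ1 : γ ≤ 1) (ht : 0 < t) (hτ : 0 ≤ τ) :
    τ ^ γ ≤ (1 - γ) * t ^ γ + γ * t ^ (γ - 1) * τ := by
  have h := Real.geom_mean_le_arith_mean2_weighted (sub_nonneg.2 hγ1) hγ0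
    (Real.rpow_nonneg ht.le γ) (mul_nonneg (Real.rpow_nonneg ht.le (γ - 1)) hτ) (by ring)
  rw [Real.mul_rpow (by positivity) hτ, ← Real.rpow_mul ht.le, ← Real.rpow_mul ht.le,
    ← mul_assoc, ← Real.rpow_add ht, show γ * (1 - γ) + (γ - 1) * γ = 0 by ring,
    Real.rpow_zero, one_mul] at h
  linarith

/-- Optimization in `t` of the two-term bound of real interpolation. -/
lemma le_rpow_mul_rpow_of_forall_le {γ A B I : ℝ} (hγ0 : 0 < γ) (hγ1 : γ < 1) (hA : 0 ≤ A)
    (hB : 0 ≤ B) (hIA : I ≤ A)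
    (hI : ∀ t : ℝ, 0 < t → I ≤ (1 - γ) * t ^ γ * A + γ * t ^ (γ - 1) * B) :
    I ≤ A ^ (1 - γ) * B ^ γ := by
  rcases hA.eq_or_lt with rfl | hA
  · rwa [Real.zero_rpow (by linarith), zero_mul]
  rcases hB.eq_or_lt with rfl | hB
  · rw [Real.zero_rpow hγ0.ne', mul_zero]
    have hlim : Filter.Tendsto (fun t : ℝ => (1 - γ) * t ^ γ * A) (nhdsWithin 0 (Set.Ioi 0))
        (nhds 0) := by
      have h : Continuous fun t : ℝ => (1 - γ) * t ^ γ * A :=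
        (continuous_const.mul (Real.continuous_rpow_const hγ0.le)).mul continuous_const
      have h' := h.tendsto 0
      simp only [Real.zero_rpow hγ0.ne', mul_zero, zero_mul] at h'
      exact h'.mono_left nhdsWithin_le_nhds
    refine ge_of_tendsto hlim ?_
    filter_upwards [self_mem_nhdsWithin] with t ht
    simpa using hI t ht
  · refine (hI (B / A) (by positivity)).trans_eq ?_
    have h₁ : (B / A) ^ γ * A = A ^ (1 - γ) * B ^ γ := by
      rw [Real.div_rpow hB.le hA.le, Real.rpow_sub hA, Real.rpow_one]
      ring
    have h₂ : (B / A) ^ (γ - 1) * B = A ^ (1 - γ) * B ^ γ := by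
      rw [← h₁, Real.rpow_sub_one (by positivity)]
      field_simp
    rw [mul_assoc, mul_assoc, h₁, h₂]
    ring

section DualNorms

variable {μ : SignedMeasure (EuclideanSpace ℝ (Fin 3))} {Ω : Set (EuclideanSpace ℝ (Fin 3))}
  {φ ψ : EuclideanSpace ℝ (Fin 3) → ℝ}

lemma integrableOn_of_continuousOn_closure {ν : Measure (EuclideanSpace ℝ (Fin 3))}
    [IsFiniteMeasure ν] (hΩb : Bornology.IsBounded Ω) (hφ : ContinuousOn φ (closure Ω)) :
    IntegrableOn φ Ω ν :=
  (hφ.integrableOn_compact hΩb.isCompact_closure).mono_set subset_closure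

lemma signedIntegral_add (hΩb : Bornology.IsBounded Ω) (hφ : ContinuousOn φ (closure Ω))
    (hψ : ContinuousOn ψ (closure Ω)) :
    signedIntegral μ Ω (fun x => φ x + ψ x)
      = signedIntegral μ Ω φ + signedIntegral μ Ω ψ := by
  unfold signedIntegral
  rw [integral_add (integrableOn_of_continuousOn_closure hΩb hφ)
      (integrableOn_of_continuousOn_closure hΩb hψ),
    integral_add (integrableOn_of_continuousOn_closure hΩb hφ)
      (integrableOn_of_continuousOn_closure hΩb hψ)]
  ring

lemma signedIntegral_const_mul (c : ℝ) :
    signedIntegral μ Ω (fun x => c * φ x) = c * signedIntegral μ Ω φ := by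
  simp only [signedIntegral, integral_const_mul]
  ring

lemma exists_signedIntegral_le :
    ∃ C : ℝ, ∀ φ : EuclideanSpace ℝ (Fin 3) → ℝ, (∀ x ∈ closure Ω, |φ x| ≤ 1) →
      signedIntegral μ Ω φ ≤ C := by
  refine ⟨μ.toJordanDecomposition.posPart.real Ω + μ.toJordanDecomposition.negPart.real Ω,
    fun φ hφ => ?_⟩
  have key (ν : Measure (EuclideanSpace ℝ (Fin 3))) [IsFiniteMeasure ν] :
      |∫ x in Ω, φ x ∂ν| ≤ ν.real Ω := by
    simpa using norm_setIntegral_le_of_norm_le_const (μ := ν) (s := Ω) (f := φ) (C := 1)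
      (measure_lt_top _ _) fun x hx => hφ x (subset_closure hx)
  have h₁ := abs_le.1 (key μ.toJordanDecomposition.posPart)
  have h₂ := abs_le.1 (key μ.toJordanDecomposition.negPart)
  unfold signedIntegral
  linarith [h₁.2, h₂.1]

lemma signedIntegral_le_dualC0Norm (hφ : ContinuousOn φ (closure Ω))
    (hφ₀ : ∀ x ∈ frontier Ω, φ x = 0) (hφ₁ : ∀ x ∈ closure Ω, |φ x| ≤ 1) :
    signedIntegral μ Ω φ ≤ dualC0Norm μ Ω := by
  obtain ⟨C, hC⟩ := exists_signedIntegral_le (μ := μ)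
  refine le_csSup ⟨C, ?_⟩ ⟨φ, hφ, hφ₀, hφ₁, rfl⟩
  rintro _ ⟨χ, -, -, hχ, rfl⟩
  exact hC χ hχ

lemma signedIntegral_le_dualHolderNorm {γ : ℝ}
    (hφ : ContinuousOn φ (closure Ω)) (hφ₀ : ∀ x ∈ frontier Ω, φ x = 0)
    (hφ₁ : ∀ x ∈ closure Ω, |φ x| ≤ 1)
    (hφγ : ∀ x ∈ closure Ω, ∀ y ∈ closure Ω, x ≠ y → |φ x - φ y| ≤ dist x y ^ γ) :
    signedIntegral μ Ω φ ≤ dualHolderNorm μ Ω γ := by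
  obtain ⟨C, hC⟩ := exists_signedIntegral_le (μ := μ)
  refine le_csSup ⟨C, ?_⟩ ⟨φ, hφ, hφ₀, hφ₁, hφγ, rfl⟩
  rintro _ ⟨χ, -, -, hχ, -, rfl⟩
  exact hC χ hχ

lemma dualC0Norm_nonneg : 0 ≤ dualC0Norm μ Ω := by
  simpa [signedIntegral] using signedIntegral_le_dualC0Norm (μ := μ) (φ := fun _ => 0)
    continuousOn_const (by simp) (by simp)

lemma dualHolderNorm_nonneg (γ : ℝ) : 0 ≤ dualHolderNorm μ Ω γ := by
  simpa [signedIntegral] using signedIntegral_le_dualHolderNorm (μ := μ) (φ := fun _ => 0)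
    (γ := γ) continuousOn_const (by simp) (by simp)
    (fun x _ y _ _ => by simpa using Real.rpow_nonneg dist_nonneg γ)

lemma signedIntegral_le_mul_dualC0Norm {δ : ℝ} (hδ : 0 < δ)
    (hφ : ContinuousOn φ (closure Ω)) (hφ₀ : ∀ x ∈ frontier Ω, φ x = 0)
    (hφδ : ∀ x ∈ closure Ω, |φ x| ≤ δ) :
    signedIntegral μ Ω φ ≤ δ * dualC0Norm μ Ω := by
  have h := signedIntegral_le_dualC0Norm (μ := μ) (φ := fun x => δ⁻¹ * φ x)
    (continuousOn_const.mul hφ) (fun x hx => by simp [hφ₀ x hx]) (fun x hx => by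
      rw [abs_mul, abs_of_pos (inv_pos.2 hδ), inv_mul_le_one₀ hδ]
      exact hφδ x hx)
  rwa [signedIntegral_const_mul, inv_mul_le_iff₀ hδ] at h

lemma signedIntegral_le_mul_dualHolderNorm_one {K : ℝ≥0} (hK : 0 < K)
    (hφ : LipschitzWith K φ) (hφ₀ : ∀ x ∈ frontier Ω, φ x = 0)
    (hφK : ∀ x ∈ closure Ω, |φ x| ≤ K) :
    signedIntegral μ Ω φ ≤ K * dualHolderNorm μ Ω 1 := by
  have hK' : (0 : ℝ) < K := hK
  have h := signedIntegral_le_dualHolderNorm (μ := μ) (φ := fun x => (K : ℝ)⁻¹ * φ x) (γ := 1)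
    (continuousOn_const.mul hφ.continuous.continuousOn) (fun x hx => by simp [hφ₀ x hx])
    (fun x hx => by
      rw [abs_mul, abs_of_pos (inv_pos.2 hK'), inv_mul_le_one₀ hK']
      exact hφK x hx)
    (fun x _ y _ _ => by
      rw [← mul_sub, abs_mul, abs_of_pos (inv_pos.2 hK'), inv_mul_le_iff₀ hK', Real.rpow_one]
      exact hφ.dist_le_mul x y)
  rwa [signedIntegral_const_mul, inv_mul_le_iff₀ hK'] at h

end DualNorms

/-- Interpolation between dual Hölder norms:
`‖μ‖_γ* ≤ (‖μ‖_0*)^{1−γ} (‖μ‖_1*)^γ` for `γ ∈ (0,1)`. -/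
theorem stmt13 (Ω : Set (EuclideanSpace ℝ (Fin 3)))
    (hΩo : IsOpen Ω) (hΩb : Bornology.IsBounded Ω)
    (μ : SignedMeasure (EuclideanSpace ℝ (Fin 3)))
    (γ : ℝ) (hγ0 : 0 < γ) (hγ1 : γ < 1) :
    dualHolderNorm μ Ω γ ≤ dualC0Norm μ Ω ^ (1 - γ) * dualHolderNorm μ Ω 1 ^ γ := by
  have hA := dualC0Norm_nonneg (μ := μ) (Ω := Ω)
  have hB := dualHolderNorm_nonneg (μ := μ) (Ω := Ω) 1
  refine Real.sSup_le ?_ (mul_nonneg (Real.rpow_nonneg hA _) (Real.rpow_nonneg hB _))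
  rintro _ ⟨φ, hφ, hφ₀, hφ₁, hφγ, rfl⟩
  refine le_rpow_mul_rpow_of_forall_le hγ0 hγ1 hA hB
    (signedIntegral_le_dualC0Norm hφ hφ₀ hφ₁) fun t ht => ?_
  have hδ : 0 < (1 - γ) * t ^ γ := mul_pos (sub_pos.2 hγ1) (Real.rpow_pos_of_pos ht _)
  have hK : 0 < γ * t ^ (γ - 1) := mul_pos hγ0 (Real.rpow_pos_of_pos ht _)
  set δ := (1 - γ) * t ^ γ
  obtain ⟨K, hKt⟩ : ∃ K : ℝ≥0, (K : ℝ) = γ * t ^ (γ - 1) := ⟨⟨_, hK.le⟩, rfl⟩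
  have hyoung (τ : ℝ) (hτ : 0 ≤ τ) : τ ^ γ ≤ δ + K * τ :=
    hKt ▸ rpow_le_add_mul hγ0.le hγ1.le ht hτ
  rw [← hKt] at hK ⊢
  obtain ⟨ψ, hψ, hψK, hφψ, hψ₀⟩ := exists_lipschitzWith_approx (s := closure Ω) K
    (by simpa using hyoung 1 zero_le_one) hφ₁ (fun x hx y hy => by
      rcases eq_or_ne x y with rfl | hxy
      · simpa using hδ.le
      · exact (le_abs_self _).trans ((hφγ x hx y hy hxy).trans (hyoung _ dist_nonneg)))
  have hψ₀' : ∀ x ∈ frontier Ω, ψ x = 0 := fun x hx =>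
    hψ₀ x (frontier_subset_closure hx) (hφ₀ x hx)
  have hψc : ContinuousOn ψ (closure Ω) := hψ.continuous.continuousOn
  have hsum := signedIntegral_add (μ := μ) (φ := fun x => φ x - ψ x) hΩb (hφ.sub hψc) hψc
  simp only [sub_add_cancel] at hsum
  rw [hsum]
  exact add_le_add
    (signedIntegral_le_mul_dualC0Norm hδ (hφ.sub hψc)
      (fun x hx => by rw [hφ₀ x hx, hψ₀' x hx, sub_zero]) hφψ)
    (signedIntegral_le_mul_dualHolderNorm_one hK hψ hψ₀' fun x _ => hψK x)
end
end

section
/- Let Ω ⊂ ℝ³ be a bounded domain with Lipschitz boundary. For any γ ∈ (0,1) there exist a rotation R₀ ∈ SO(3), constants c₀, c₁ > 0 depending only on γ, a constant δ₀ ∈ (0,1) depending only on Ω, and a universal constant C > 0 such that the following holds. For any ε, δ > 0 satisfying ε^{(1−γ)/2} ≤ c₀ and c₁ ε^{(1−γ)/4} ≤ δ ≤ δ₀, and any u ∈ C¹(Ω̄, ℂ), A ∈ C¹(Ω̄, ℝ³) with F_ε(u,A) ≤ ε^{−γ}, there exists b ∈ Ω such that, denoting by 𝔊(b, R₀, δ)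 the grid of closed cubes of side length δ obtained by rotating the standard lattice partition of ℝ³ into cubes δ·z + [0,δ]³ (z ∈ ℤ³) by R₀ and translating by b, and denoting by ℜ₁ the union of all edges of these cubes and by ℜ₂ the union of all their faces: (i) |u(x)| > 5/8 for every x ∈ ℜ₁ ∩ Ω; (ii) ∫_{ℜ₁ ∩ Ω} e_ε(u,A) dℋ¹ ≤ C δ^{−2} F_ε(u,A); (iii) ∫_{ℜ₂ ∩ Ω} e_ε(u,A) dℋ² ≤ C δ^{−1} F_ε(u,A). -/
open MeasureTheory Metric
open scoped BigOperators

noncomputable section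

/-- Partial derivative in the `k`-th coordinate direction of a scalar function on `ℝ³`. -/
def pderiv3 (f : EuclideanSpace ℝ (Fin 3) → ℝ) (k : Fin 3)
    (x : EuclideanSpace ℝ (Fin 3)) : ℝ :=
  fderiv ℝ f x (EuclideanSpace.single k 1)

/-- The curl of a vector field on `ℝ³`. -/
def curl3 (A : EuclideanSpace ℝ (Fin 3) → EuclideanSpace ℝ (Fin 3))
    (x : EuclideanSpace ℝ (Fin 3)) : EuclideanSpace ℝ (Fin 3) :=
  (WithLp.equiv 2 (Fin 3 → ℝ)).symm
    ![pderiv3 (fun y => A y 2) 1 x - pderiv3 (fun y => A y 1) 2 x,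
      pderiv3 (fun y => A y 0) 2 x - pderiv3 (fun y => A y 2) 0 x,
      pderiv3 (fun y => A y 1) 0 x - pderiv3 (fun y => A y 0) 1 x]

/-- The Ginzburg–Landau energy density
`e_ε(u,A) = (1/2)|∇u − iAu|² + (1/(4ε²))(1−|u|²)² + |curl A|²`. -/
def eDensity3 (ε : ℝ) (u : EuclideanSpace ℝ (Fin 3) → ℂ)
    (A : EuclideanSpace ℝ (Fin 3) → EuclideanSpace ℝ (Fin 3))
    (x : EuclideanSpace ℝ (Fin 3)) : ℝ :=
  (1 / 2) * (∑ k : Fin 3, ‖fderiv ℝ u x (EuclideanSpace.single k 1)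
      - Complex.I * (A x k : ℂ) * u x‖ ^ 2)
  + (1 / (4 * ε ^ 2)) * (1 - ‖u x‖ ^ 2) ^ 2 + ‖curl3 A x‖ ^ 2

/-- The Ginzburg–Landau free energy
`F_ε(u,A) = (1/2)∫_Ω |∇u − iAu|² + (1/(2ε²))(1 − |u|²)² + |curl A|²`. -/
def freeEnergy3 (ε : ℝ) (u : EuclideanSpace ℝ (Fin 3) → ℂ)
    (A : EuclideanSpace ℝ (Fin 3) → EuclideanSpace ℝ (Fin 3))
    (Ω : Set (EuclideanSpace ℝ (Fin 3))) : ℝ :=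
  (1 / 2) * ∫ x in Ω,
    ((∑ k : Fin 3, ‖fderiv ℝ u x (EuclideanSpace.single k 1)
        - Complex.I * (A x k : ℂ) * u x‖ ^ 2)
      + (1 / (2 * ε ^ 2)) * (1 - ‖u x‖ ^ 2) ^ 2 + ‖curl3 A x‖ ^ 2)

/-- A set of `ℝ³` has Lipschitz boundary if near every boundary point, after a rigid
motion, the set is the subgraph of a Lipschitz function. -/
def HasLipschitzBoundary (Ω : Set (EuclideanSpace ℝ (Fin 3))) : Prop :=
  ∀ x ∈ frontier Ω,
    ∃ (g : EuclideanSpace ℝ (Fin 3) ≃ᵢ EuclideanSpace ℝ (Fin 3)) (K : NNReal)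
      (f : ℝ × ℝ → ℝ) (r : ℝ), 0 < r ∧ LipschitzWith K f ∧
      ∀ y ∈ ball x r, (y ∈ Ω ↔ g y 2 < f (g y 0, g y 1))

/-- The union of all edges of the cubes of the standard lattice of side length `δ`:
points with at least two coordinates in `δℤ`. -/
def latticeEdges (δ : ℝ) : Set (EuclideanSpace ℝ (Fin 3)) :=
  {x | ∃ i j : Fin 3, i ≠ j ∧ (∃ z : ℤ, x i = δ * z) ∧ (∃ z : ℤ, x j = δ * z)}

/-- The union of all faces of the cubes of the standard lattice of side length `δ`:
points with at least one coordinate in `δℤ`. -/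
def latticeFaces (δ : ℝ) : Set (EuclideanSpace ℝ (Fin 3)) :=
  {x | ∃ i : Fin 3, ∃ z : ℤ, x i = δ * z}

open scoped ENNReal NNReal

local notation "E3" => EuclideanSpace ℝ (Fin 3)

/-- The half-open cube of side `δ` with corner `a`. -/
def halfOpenCell (a : E3) (δ : ℝ) : Set E3 := {y | ∀ i, y i ∈ Set.Ioc (a i) (a i + δ)}

lemma lattice_point_eq_of_mem_Ioc {δ a : ℝ} (hδ : 0 < δ) {z : ℤ}
    (h : δ * z ∈ Set.Ioc a (a + δ)) : δ * z = δ * ⌊a / δ + 1⌋ := by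
  have : ⌊a / δ + 1⌋ = z := by
    rw [Int.floor_eq_iff]
    have h1 : a / δ < z := by rw [div_lt_iff₀ hδ]; linarith [h.1]
    have h2 : (z : ℝ) ≤ a / δ + 1 := by
      rw [div_add_one hδ.ne', le_div_iff₀ hδ]; linarith [h.2]
    exact ⟨h2, by linarith⟩
  rw [this]

lemma isometry_add_sub_smul_single (c : E3) (r : ℝ) (k : Fin 3) :
    Isometry fun t : ℝ => c + (t - r) • EuclideanSpace.single k (1 : ℝ) := by
  refine Isometry.of_dist_eq fun s t => ?_
  rw [dist_add_left, dist_eq_norm, ← sub_smul, norm_smul]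
  simp [Real.dist_eq]

lemma hausdorffMeasure_latticeEdges_inter_cell_le {δ : ℝ} (hδ : 0 < δ) (a : E3) :
    μH[1] (latticeEdges δ ∩ halfOpenCell a δ) ≤ 3 * ENNReal.ofReal δ := by
  set c : E3 := WithLp.toLp 2 fun i => δ * ⌊a i / δ + 1⌋ with hc
  let φ : Fin 3 → ℝ → E3 := fun k t => c + (t - c k) • EuclideanSpace.single k (1 : ℝ)
  have hφ : ∀ k, Isometry (φ k) := fun k => isometry_add_sub_smul_single c (c k) k
  have hsub : latticeEdges δ ∩ halfOpenCell a δ ⊆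
      ⋃ k, φ k '' Set.Icc (a k) (a k + δ) := by
    rintro y ⟨⟨i, j, hij, ⟨z, hz⟩, ⟨w, hw⟩⟩, hy⟩
    obtain ⟨k, hk⟩ : ∃ k, ∀ m, m ≠ k → m = i ∨ m = j := by
      clear hz hw; revert i j; decide
    refine Set.mem_iUnion.2 ⟨k, y k, Set.Ioc_subset_Icc_self (hy k), ?_⟩
    ext m
    by_cases hmk : m = k
    · subst hmk; simp [φ]
    · have : y m = c m := by
        rcases hk m hmk with rfl | rfl
        · have := hy m
          rw [hz] at this ⊢
          exact lattice_point_eq_of_mem_Ioc hδ this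
        · have := hy m
          rw [hw] at this ⊢
          exact lattice_point_eq_of_mem_Ioc hδ this
      simp [φ, hmk, this]
  calc μH[1] (latticeEdges δ ∩ halfOpenCell a δ)
      ≤ ∑' k, μH[1] (φ k '' Set.Icc (a k) (a k + δ)) :=
        (measure_mono hsub).trans (measure_iUnion_le _)
    _ = 3 * ENNReal.ofReal δ := by
        simp only [(hφ _).hausdorffMeasure_image (Or.inl zero_le_one), hausdorffMeasure_real,
          Real.volume_Icc, tsum_fintype]
        simp

lemma hausdorffMeasure_latticeFaces_inter_cell_le {δ : ℝ} (hδ : 0 < δ) (a : E3) :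
    μH[2] (latticeFaces δ ∩ halfOpenCell a δ) ≤ 9 * ENNReal.ofReal (δ ^ 2) := by
  set c : E3 := WithLp.toLp 2 fun i => δ * ⌊a i / δ + 1⌋ with hc
  let φ : Fin 3 → (Fin 2 → ℝ) → E3 := fun k w =>
    WithLp.toLp 2 (Fin.insertNth (α := fun _ => ℝ) k (c k) w)
  have hφ : ∀ k, LipschitzWith ((3 : ℝ≥0) ^ (1 / (2 : ℝ))) (φ k) := fun k => by
    have h1 : LipschitzWith 1 fun w : Fin 2 → ℝ => Fin.insertNth (α := fun _ => ℝ) k (c k) w := by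
      refine LipschitzWith.of_dist_le_mul fun v w => ?_
      rw [NNReal.coe_one, one_mul]
      refine (dist_pi_le_iff dist_nonneg).2 fun m => ?_
      cases m using Fin.succAboveCases k with
      | x => simp
      | p j => simpa using dist_le_pi_dist v w j
    have h2 := (PiLp.lipschitzWith_toLp 2 (fun _ : Fin 3 => ℝ)).comp h1
    simpa [Function.comp_def] using h2
  have hsub : latticeFaces δ ∩ halfOpenCell a δ ⊆
      ⋃ k, φ k '' Set.Icc (fun j => a (k.succAbove j)) (fun j => a (k.succAbove j) + δ) := by
    rintro y ⟨⟨k, z, hz⟩, hy⟩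
    refine Set.mem_iUnion.2 ⟨k, fun j => y (k.succAbove j),
      ⟨fun j => (hy _).1.le, fun j => (hy _).2⟩, ?_⟩
    have : c k = y k := by
      have := hy k
      rw [hz] at this ⊢
      exact (lattice_point_eq_of_mem_Ioc hδ this).symm
    ext m
    cases m using Fin.succAboveCases k with
    | x => simp [φ, this]
    | p j => simp [φ]
  have hbox : ∀ k : Fin 3, μH[2] (φ k '' Set.Icc (fun j => a (k.succAbove j))
      (fun j => a (k.succAbove j) + δ)) ≤ 3 * ENNReal.ofReal (δ ^ 2) := fun k => by
    refine ((hφ k).hausdorffMeasure_image_le zero_le_two _).trans ?_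
    have h2 : (μH[2] : Measure (Fin 2 → ℝ)) = volume := by
      simpa using hausdorffMeasure_pi_real (ι := Fin 2)
    rw [h2, Real.volume_Icc_pi]
    have h3 : (((3 : ℝ≥0) ^ (1 / (2 : ℝ)) : ℝ≥0) : ℝ≥0∞) ^ (2 : ℝ) = 3 := by
      rw [ENNReal.coe_rpow_of_nonneg _ (by norm_num), ← ENNReal.rpow_mul]
      norm_num
    rw [h3]
    simp [ENNReal.ofReal_pow hδ.le]
  calc μH[2] (latticeFaces δ ∩ halfOpenCell a δ)
      ≤ ∑' k, μH[2] (φ k '' Set.Icc (fun j => a (k.succAbove j))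
          (fun j => a (k.succAbove j) + δ)) :=
        (measure_mono hsub).trans (measure_iUnion_le _)
    _ ≤ ∑' _ : Fin 3, 3 * ENNReal.ofReal (δ ^ 2) := ENNReal.tsum_le_tsum hbox
    _ = 9 * ENNReal.ofReal (δ ^ 2) := by
        rw [tsum_fintype]
        simp [← mul_assoc]; norm_num

lemma sFinite_restrict_of_cell_le {μ : Measure E3} {δ : ℝ} (hδ : 0 < δ) {L : Set E3}
    {κ : ℝ≥0∞} (hκ : κ ≠ ∞) (h : ∀ a, μ (L ∩ halfOpenCell a δ) ≤ κ) :
    SFinite (μ.restrict L) := by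
  have : IsLocallyFiniteMeasure (μ.restrict L) := by
    refine ⟨fun x => ?_⟩
    refine ⟨ball x (δ / 2), ball_mem_nhds x (by positivity), ?_⟩
    rw [Measure.restrict_apply measurableSet_ball]
    refine lt_of_le_of_lt ((measure_mono ?_).trans
      (h (WithLp.toLp 2 fun i => x i - δ / 2))) hκ.lt_top
    rintro y ⟨hy, hyL⟩
    refine ⟨hyL, fun i => ?_⟩
    have h1 : |y i - x i| < δ / 2 := by
      refine lt_of_le_of_lt ?_ (mem_ball_iff_norm.1 hy)
      simpa using PiLp.norm_apply_le (y - x) i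
    rw [abs_lt] at h1
    constructor <;> simp <;> linarith
  infer_instance

/-- Averaging over translations by a cube: if `μ` restricted to `L` gives mass at most `κ` to each
cell, then the integral over `b ∈ Q` of the integral of `H` over `b + L` is at most
`κ` times the volume integral of `H`. -/
lemma lintegral_cell_lintegral_translate_le {μ : Measure E3} {δ : ℝ} (hδ : 0 < δ) {L : Set E3}
    {κ : ℝ≥0∞} (hκ : κ ≠ ∞) (h : ∀ a, μ (L ∩ halfOpenCell a δ) ≤ κ) (a : E3)
    {H : E3 → ℝ≥0∞} (hH : Measurable H) :
    Measurable (fun b => ∫⁻ y in L, H (b + y) ∂μ) ∧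
    ∫⁻ b in {b : E3 | ∀ i, b i ∈ Set.Ico (a i) (a i + δ)}, ∫⁻ y in L, H (b + y) ∂μ
      ≤ κ * ∫⁻ x, H x := by
  have := sFinite_restrict_of_cell_le hδ hκ h
  set Q : Set E3 := {b : E3 | ∀ i, b i ∈ Set.Ico (a i) (a i + δ)} with hQ
  have hQm : MeasurableSet Q := by
    have : Q = ⋂ i, (fun b : E3 => b i) ⁻¹' Set.Ico (a i) (a i + δ) := by ext; simp [hQ]
    rw [this]
    exact MeasurableSet.iInter fun i => measurableSet_Ico.preimage (by fun_prop)
  have hm : Measurable (Function.uncurry fun b y : E3 => H (b + y)) :=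
    hH.comp (measurable_fst.add measurable_snd)
  refine ⟨hm.lintegral_prod_right, ?_⟩
  have hm2 : Measurable (Function.uncurry fun y x : E3 => Q.indicator 1 (x - y) * H x) := by
    refine Measurable.mul ?_ (hH.comp measurable_snd)
    exact (measurable_one.indicator hQm).comp (measurable_snd.sub measurable_fst)
  calc ∫⁻ b in Q, ∫⁻ y in L, H (b + y) ∂μ
      = ∫⁻ y in L, (∫⁻ b in Q, H (b + y)) ∂μ := lintegral_lintegral_swap hm.aemeasurable
    _ = ∫⁻ y in L, (∫⁻ x, Q.indicator 1 (x - y) * H x) ∂μ := by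
        refine lintegral_congr fun y => ?_
        rw [← lintegral_indicator hQm,
          ← lintegral_add_right_eq_self (fun x => Q.indicator 1 (x - y) * H x) y]
        refine lintegral_congr fun b => ?_
        by_cases hb : b ∈ Q <;> simp [hb]
    _ = ∫⁻ x, (∫⁻ y in L, Q.indicator 1 (x - y) * H x ∂μ) :=
        lintegral_lintegral_swap hm2.aemeasurable
    _ ≤ ∫⁻ x, κ * H x := by
        refine lintegral_mono fun x => ?_
        have hmx : Measurable fun y : E3 => Q.indicator (1 : E3 → ℝ≥0∞) (x - y) :=
          (measurable_one.indicator hQm).comp (measurable_const.sub measurable_id)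
        have hpre : MeasurableSet ((fun y => x - y) ⁻¹' Q) :=
          hQm.preimage (measurable_const.sub measurable_id)
        rw [lintegral_mul_const _ hmx]
        gcongr
        have : (fun y : E3 => Q.indicator (1 : E3 → ℝ≥0∞) (x - y))
            = ((fun y => x - y) ⁻¹' Q).indicator 1 := by
          ext y; simp [Set.indicator]
        rw [this, lintegral_indicator_one hpre, Measure.restrict_apply hpre]
        refine (measure_mono ?_).trans (h (WithLp.toLp 2 fun i => x i - a i - δ))
        rintro y ⟨hy, hyL⟩
        refine ⟨hyL, fun i => ?_⟩
        have := hy i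
        simp only [PiLp.sub_apply, Set.mem_Ico] at this
        constructor <;> simp <;> linarith
    _ = κ * ∫⁻ x, H x := lintegral_const_mul _ hH

/-- Every unit-direction segment of length at most `1` that starts on `S` and stays in `Ω` carries
`H`-mass at least its length. -/
def SegmentMassBound (Ω S : Set E3) (H : E3 → ℝ≥0∞) : Prop :=
  ∀ x ∈ S, ∀ v : E3, ‖v‖ = 1 → ∀ l : ℝ, 0 < l → l ≤ 1 →
    (∀ s ∈ Set.Ioo 0 l, x + s • v ∈ Ω) → ENNReal.ofReal l ≤ ∫⁻ s in Set.Ioo 0 l, H (x + s • v)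

lemma exists_linearIsometryEquiv_symm_apply (g : E3 ≃ᵢ E3) :
    ∃ B : E3 ≃ₗᵢ[ℝ] E3, ∀ x, g.symm x = B x + g.symm 0 := by
  let A := g.symm.toRealAffineIsometryEquiv
  refine ⟨A.linearIsometryEquiv, fun x => ?_⟩
  have h := A.map_vadd 0 x
  simpa [A] using h

lemma insertNth_two_eq (t : ℝ) (w : Fin 2 → ℝ) :
    Fin.insertNth (α := fun _ => ℝ) (2 : Fin 3) t w = ![w 0, w 1, t] := by
  ext i
  fin_cases i
  · exact Fin.insertNth_apply_succAbove (α := fun _ => ℝ) (2 : Fin 3) t w 0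
  · exact Fin.insertNth_apply_succAbove (α := fun _ => ℝ) (2 : Fin 3) t w 1
  · exact Fin.insertNth_apply_same (α := fun _ => ℝ) (2 : Fin 3) t w

lemma lintegral_lintegral_isometryEquiv_symm (g : E3 ≃ᵢ E3) {H : E3 → ℝ≥0∞} (hH : Measurable H) :
    Measurable (fun w : Fin 2 → ℝ => ∫⁻ t : ℝ, H (g.symm (WithLp.toLp 2 ![w 0, w 1, t]))) ∧
    ∫⁻ w : Fin 2 → ℝ, ∫⁻ t : ℝ, H (g.symm (WithLp.toLp 2 ![w 0, w 1, t])) = ∫⁻ x, H x := by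
  obtain ⟨B, hB⟩ := exists_linearIsometryEquiv_symm_apply g
  have hg : MeasurePreserving g.symm (volume : Measure E3) volume := by
    have h := (measurePreserving_add_right (volume : Measure E3) (g.symm 0)).comp
      B.measurePreserving
    rwa [show ⇑g.symm = (fun x => x + g.symm 0) ∘ B from funext hB]
  have h2 : MeasurePreserving
      (fun p : ℝ × (Fin 2 → ℝ) => g.symm (WithLp.toLp 2 ![p.2 0, p.2 1, p.1])) volume volume := by
    have h := hg.comp ((PiLp.volume_preserving_toLp (Fin 3)).comp
      (volume_preserving_piFinSuccAbove (fun _ : Fin 3 => ℝ) 2).symm)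
    have heq : (fun p : ℝ × (Fin 2 → ℝ) => g.symm (WithLp.toLp 2 ![p.2 0, p.2 1, p.1])) =
        g.symm ∘ WithLp.toLp 2 ∘ (MeasurableEquiv.piFinSuccAbove (fun _ : Fin 3 => ℝ) 2).symm :=
      funext fun p => by rw [← insertNth_two_eq]; rfl
    rwa [heq]
  have hm : Measurable fun p : ℝ × (Fin 2 → ℝ) =>
      H (g.symm (WithLp.toLp 2 ![p.2 0, p.2 1, p.1])) := hH.comp h2.measurable
  refine ⟨hm.lintegral_prod_left', ?_⟩
  rw [← h2.lintegral_comp hH, Measure.volume_eq_prod, lintegral_prod_symm' _ hm]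

lemma lipschitzWith_graph (g : E3 ≃ᵢ E3) {K : ℝ≥0} {f : ℝ × ℝ → ℝ} (hf : LipschitzWith K f) :
    ∃ M : ℝ≥0, LipschitzWith M
      (fun w : Fin 2 → ℝ => g.symm (WithLp.toLp 2 ![w 0, w 1, f (w 0, w 1)])) := by
  have h1 : LipschitzWith (max 1 K) fun w : Fin 2 → ℝ => ![w 0, w 1, f (w 0, w 1)] := by
    refine LipschitzWith.of_dist_le_mul fun v w => ?_
    have hc : ∀ i, dist (v i) (w i) ≤ dist v w := dist_le_pi_dist v w
    have h0 : (0 : ℝ) ≤ dist v w := dist_nonneg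
    have hle : ∀ a : ℝ≥0, a ≤ max 1 K → a * dist v w ≤ ((max 1 K : ℝ≥0) : ℝ) * dist v w :=
      fun a ha => mul_le_mul_of_nonneg_right (NNReal.coe_le_coe.2 ha) h0
    have hone := hle 1 (le_max_left _ _)
    rw [NNReal.coe_one, one_mul] at hone
    refine (dist_pi_le_iff (by positivity)).2 fun m => ?_
    fin_cases m
    · exact (hc 0).trans hone
    · exact (hc 1).trans hone
    · refine (hf.dist_le_mul _ _).trans (le_trans ?_ (hle K (le_max_right _ _)))
      gcongr
      exact max_le (hc 0) (hc 1)
  exact ⟨_, g.symm.isometry.lipschitz.comp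
    ((PiLp.lipschitzWith_toLp 2 (fun _ : Fin 3 => ℝ)).comp h1)⟩

lemma eq_graph_of_mem_frontier {Ω : Set E3} (hΩ : IsOpen Ω) {g : E3 ≃ᵢ E3} {f : ℝ × ℝ → ℝ}
    (hf : Continuous f) {U : Set E3} (hU : IsOpen U)
    (h : ∀ y ∈ U, (y ∈ Ω ↔ g y 2 < f (g y 0, g y 1))) {x : E3} (hx : x ∈ frontier Ω)
    (hxU : x ∈ U) : g x 2 = f (g x 0, g x 1) := by
  have hg : ∀ i, Continuous fun y => g y i := fun i => by
    have := g.continuous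
    fun_prop
  rcases lt_trichotomy (g x 2) (f (g x 0, g x 1)) with h1 | h1 | h1
  · have : x ∈ Ω := (h x hxU).2 h1
    rw [hΩ.frontier_eq] at hx
    exact absurd this hx.2
  · exact h1
  · have hV : IsOpen {y | f (g y 0, g y 1) < g y 2} :=
      isOpen_lt (hf.comp ((hg 0).prodMk (hg 1))) (hg 2)
    obtain ⟨y, ⟨hyV, hyU⟩, hyΩ⟩ :=
      mem_closure_iff.1 (frontier_subset_closure hx) _ (hV.inter hU) ⟨h1, hxU⟩
    exact absurd ((h y hyU).1 hyΩ) (not_lt.2 (le_of_lt hyV))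

lemma exists_trace_bound_near {Ω : Set E3} (hΩ : IsOpen Ω) (hL : HasLipschitzBoundary Ω) {p : E3}
    (hp : p ∈ frontier Ω) :
    ∃ ρ > 0, ∃ C : ℝ≥0, ∀ S ⊆ frontier Ω, ∀ H : E3 → ℝ≥0∞, Measurable H →
      SegmentMassBound Ω S H → μH[2] (S ∩ ball p ρ) ≤ C * ∫⁻ x, H x := by
  obtain ⟨g, K, f, r, hr, hf, hg⟩ := hL p hp
  obtain ⟨M, hM⟩ := lipschitzWith_graph g hf
  obtain ⟨B, hB⟩ := exists_linearIsometryEquiv_symm_apply g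
  set l : ℝ := min (r / 2) 1 with hl
  have hl0 : 0 < l := lt_min (by positivity) one_pos
  refine ⟨r / 2, by positivity, M ^ 2 / Real.toNNReal l, fun S hS H hH hSH => ?_⟩
  set v : E3 := B (EuclideanSpace.single 2 (-1)) with hv
  have hv1 : ‖v‖ = 1 := by simp [hv]
  set Γ : (Fin 2 → ℝ) → E3 := fun w => g.symm (WithLp.toLp 2 ![w 0, w 1, f (w 0, w 1)]) with hΓ
  set h : (Fin 2 → ℝ) → ℝ≥0∞ := fun w => ∫⁻ t : ℝ, H (g.symm (WithLp.toLp 2 ![w 0, w 1, t]))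
  have hgraph : ∀ x ∈ S ∩ ball p (r / 2), g x 2 = f (g x 0, g x 1) := fun x hx =>
    eq_graph_of_mem_frontier hΩ hf.continuous isOpen_ball hg (hS hx.1)
      (ball_subset_ball (by linarith) hx.2)
  have hshift : ∀ (w : Fin 2 → ℝ) (s : ℝ),
      Γ w + s • v = g.symm (WithLp.toLp 2 ![w 0, w 1, f (w 0, w 1) - s]) := fun w s => by
    rw [hΓ]
    simp only
    rw [hB, hB (WithLp.toLp 2 ![w 0, w 1, f (w 0, w 1) - s]), add_right_comm, hv, ← map_smul,
      ← map_add]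
    congr 2
    ext i
    fin_cases i <;> simp [sub_eq_add_neg]
  have hD : {w | Γ w ∈ S ∩ ball p (r / 2)} ⊆ {w | ENNReal.ofReal l ≤ h w} := by
    intro w hw
    have hin : ∀ s ∈ Set.Ioo 0 l, Γ w + s • v ∈ Ω := fun s hs => by
      have hball : Γ w + s • v ∈ ball p r := by
        rw [mem_ball, dist_eq_norm]
        have h1 : ‖Γ w - p‖ < r / 2 := by simpa [dist_eq_norm] using hw.2
        have h2 : ‖s • v‖ < r / 2 := by
          rw [norm_smul, hv1, mul_one, Real.norm_of_nonneg hs.1.le]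
          exact hs.2.trans_le (min_le_left _ _)
        calc ‖Γ w + s • v - p‖ = ‖(Γ w - p) + s • v‖ := by congr 1; abel
          _ ≤ ‖Γ w - p‖ + ‖s • v‖ := norm_add_le _ _
          _ < r := by linarith
      rw [hg _ hball, hshift, g.apply_symm_apply]
      simpa using hs.1
    refine (hSH _ hw.1 v hv1 l hl0 (min_le_right _ _) hin).trans ?_
    calc ∫⁻ s in Set.Ioo 0 l, H (Γ w + s • v) ≤ ∫⁻ s, H (Γ w + s • v) := setLIntegral_le_lintegral _ _
      _ = ∫⁻ s, H (g.symm (WithLp.toLp 2 ![w 0, w 1, f (w 0, w 1) - s])) := by simp only [hshift]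
      _ = h w := lintegral_sub_left_eq_self
          (fun t => H (g.symm (WithLp.toLp 2 ![w 0, w 1, t]))) (f (w 0, w 1))
  have himg : S ∩ ball p (r / 2) ⊆ Γ '' {w | Γ w ∈ S ∩ ball p (r / 2)} := by
    intro x hx
    have hx' : Γ ![g x 0, g x 1] = x := by
      simp only [hΓ, Matrix.cons_val_zero, Matrix.cons_val_one]
      rw [g.symm_apply_eq, ← hgraph x hx]
      ext i
      fin_cases i <;> rfl
    exact ⟨_, show Γ _ ∈ _ by rwa [hx'], hx'⟩
  obtain ⟨hhm, hhint⟩ := lintegral_lintegral_isometryEquiv_symm g hH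
  have hvol : (μH[2] : Measure (Fin 2 → ℝ)) = volume := by
    simpa using hausdorffMeasure_pi_real (ι := Fin 2)
  calc μH[2] (S ∩ ball p (r / 2))
      ≤ μH[2] (Γ '' {w | Γ w ∈ S ∩ ball p (r / 2)}) := measure_mono himg
    _ ≤ (M : ℝ≥0∞) ^ (2 : ℝ) * μH[2] {w | Γ w ∈ S ∩ ball p (r / 2)} :=
        hM.hausdorffMeasure_image_le zero_le_two _
    _ ≤ (M : ℝ≥0∞) ^ (2 : ℝ) * ((∫⁻ w, h w) / ENNReal.ofReal l) := by
        rw [hvol]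
        gcongr
        exact (measure_mono hD).trans
          (meas_ge_le_lintegral_div hhm.aemeasurable (by simpa using hl0) ENNReal.ofReal_ne_top)
    _ = ((M ^ 2 / Real.toNNReal l : ℝ≥0) : ℝ≥0∞) * ∫⁻ x, H x := by
        rw [hhint, ENNReal.coe_div (by simpa using hl0), ENNReal.ofReal, div_eq_mul_inv,
          div_eq_mul_inv, ENNReal.rpow_two, ENNReal.coe_pow]
        ring

/-- Trace estimate for bounded Lipschitz domains: a boundary set from which all inner segments carry
a definite proportion of `H` has area controlled by the integral of `H`. -/
lemma exists_trace_bound {Ω : Set E3} (hΩ : IsOpen Ω) (hb : Bornology.IsBounded Ω)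
    (hL : HasLipschitzBoundary Ω) :
    ∃ C : ℝ≥0, ∀ S ⊆ frontier Ω, ∀ H : E3 → ℝ≥0∞, Measurable H →
      SegmentMassBound Ω S H → μH[2] S ≤ C * ∫⁻ x, H x := by
  have hc : IsCompact (frontier Ω) :=
    hb.isCompact_closure.of_isClosed_subset isClosed_frontier frontier_subset_closure
  obtain ⟨C, hC⟩ : ∃ C : ℝ≥0, ∀ S ⊆ frontier Ω, ∀ H : E3 → ℝ≥0∞, Measurable H →
      SegmentMassBound Ω S H → μH[2] (S ∩ frontier Ω) ≤ C * ∫⁻ x, H x := by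
    refine hc.induction_on (p := fun T => ∃ C : ℝ≥0, ∀ S ⊆ frontier Ω, ∀ H : E3 → ℝ≥0∞,
      Measurable H → SegmentMassBound Ω S H → μH[2] (S ∩ T) ≤ C * ∫⁻ x, H x) ?_ ?_ ?_ ?_
    · exact ⟨0, by simp⟩
    · rintro s t hst ⟨C, hC⟩
      exact ⟨C, fun S hS H hH hSH =>
        (measure_mono (Set.inter_subset_inter_right _ hst)).trans (hC S hS H hH hSH)⟩
    · rintro s t ⟨C, hC⟩ ⟨C', hC'⟩
      refine ⟨C + C', fun S hS H hH hSH => ?_⟩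
      rw [Set.inter_union_distrib_left, ENNReal.coe_add, add_mul]
      exact (measure_union_le _ _).trans (add_le_add (hC S hS H hH hSH) (hC' S hS H hH hSH))
    · intro x hx
      obtain ⟨ρ, hρ, C, hC⟩ := exists_trace_bound_near hΩ hL hx
      exact ⟨ball x ρ, mem_nhdsWithin_of_mem_nhds (ball_mem_nhds x hρ), C, hC⟩
  refine ⟨C, fun S hS H hH hSH => ?_⟩
  simpa [Set.inter_eq_left.2 hS] using hC S hS H hH hSH

/-- The fundamental theorem of calculus as an inequality, with no integrability hypothesis. -/
lemma ofReal_abs_sub_le_setLIntegral {h h' : ℝ → ℝ} {a b : ℝ} (hab : a ≤ b)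
    (hc : ContinuousOn h (Set.Icc a b)) (hd : ∀ x ∈ Set.Ioo a b, HasDerivAt h (h' x) x)
    {G : ℝ → ℝ≥0∞} (hG : ∀ x ∈ Set.Ioo a b, ENNReal.ofReal |h' x| ≤ G x) :
    ENNReal.ofReal |h b - h a| ≤ ∫⁻ x in Set.Ioo a b, G x := by
  have hle : ∫⁻ x in Set.Ioo a b, ‖deriv h x‖ₑ ≤ ∫⁻ x in Set.Ioo a b, G x :=
    setLIntegral_mono' measurableSet_Ioo fun x hx => by
      rw [(hd x hx).deriv, Real.enorm_eq_ofReal_abs]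
      exact hG x hx
  refine le_trans ?_ hle
  by_cases hfin : ∫⁻ x in Set.Ioo a b, ‖deriv h x‖ₑ = ∞
  · simp [hfin]
  have hint : IntegrableOn (deriv h) (Set.Ioo a b) :=
    ⟨(measurable_deriv h).aestronglyMeasurable, lt_top_iff_ne_top.2 hfin⟩
  have hftc := intervalIntegral.integral_eq_sub_of_hasDerivAt_of_le hab hc
    (fun x hx => (hd x hx).differentiableAt.hasDerivAt)
    ((intervalIntegrable_iff_integrableOn_Ioo_of_le hab).2 hint)
  rw [← hftc, intervalIntegral.integral_of_le hab, integral_Ioc_eq_integral_Ioo,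
    ← Real.enorm_eq_ofReal_abs]
  exact enorm_integral_le_lintegral_enorm _

/-- A `C¹` function up to the compact closure of an open set has bounded derivative. -/
lemma exists_norm_fderiv_le {F : Type*} [NormedAddCommGroup F] [NormedSpace ℝ F] {Ω : Set E3}
    (hΩ : IsOpen Ω) (hb : Bornology.IsBounded Ω) {f : E3 → F}
    (hf : ContDiffOn ℝ 1 f (closure Ω)) : ∃ M, ∀ x ∈ Ω, ‖fderiv ℝ f x‖ ≤ M := by
  obtain ⟨M, hM⟩ : ∃ M, ∀ x ∈ Ω ∩ closure Ω, ‖fderiv ℝ f x‖ ≤ M := by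
    refine hb.isCompact_closure.induction_on
      (p := fun T => ∃ M, ∀ x ∈ Ω ∩ T, ‖fderiv ℝ f x‖ ≤ M) ?_ ?_ ?_ ?_
    · exact ⟨0, by simp⟩
    · rintro s t hst ⟨M, hM⟩
      exact ⟨M, fun x hx => hM x ⟨hx.1, hst hx.2⟩⟩
    · rintro s t ⟨M, hM⟩ ⟨M', hM'⟩
      refine ⟨max M M', fun x hx => ?_⟩
      rcases hx.2 with h | h
      · exact (hM x ⟨hx.1, h⟩).trans (le_max_left _ _)
      · exact (hM' x ⟨hx.1, h⟩).trans (le_max_right _ _)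
    · intro x hx
      have h1 : ContDiffWithinAt ℝ (0 + 1) f (closure Ω) x := by simpa using hf x hx
      obtain ⟨w, hw, -, f', hf', hc⟩ :=
        (contDiffWithinAt_succ_iff_hasFDerivWithinAt (by simp)).1 h1
      rw [Set.insert_eq_of_mem hx] at hw
      have hxw : x ∈ w := mem_of_mem_nhdsWithin hx hw
      have hcont : ContinuousWithinAt f' w x := hc.continuousWithinAt
      have hev : ∀ᶠ y in nhdsWithin x w, ‖f' y‖ < ‖f' x‖ + 1 :=
        hcont.norm.eventually (gt_mem_nhds (by linarith))
      obtain ⟨V, hV, hxV, hVw⟩ := mem_nhdsWithin.1 hw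
      obtain ⟨V', hV', hxV', hVw'⟩ := mem_nhdsWithin.1 hev
      refine ⟨V ∩ V', mem_nhdsWithin_of_mem_nhds ((hV.inter hV').mem_nhds ⟨hxV, hxV'⟩),
        ‖f' x‖ + 1, fun y hy => ?_⟩
      have hyw : w ∈ nhds y := Filter.mem_of_superset
        ((hV.inter hΩ).mem_nhds ⟨hy.2.1, hy.1⟩)
        fun z hz => hVw ⟨hz.1, subset_closure hz.2⟩
      have hyw' := mem_of_mem_nhds hyw
      rw [((hf' y hyw').hasFDerivAt hyw).fderiv]
      have hlt : ‖f' y‖ < ‖f' x‖ + 1 := hVw' ⟨hy.2.2, hyw'⟩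
      exact hlt.le
  exact ⟨M, fun x hx => hM x ⟨hx, subset_closure hx⟩⟩

lemma pderiv3_apply {A : E3 → E3} {x : E3} (hA : DifferentiableAt ℝ A x) (i k : Fin 3) :
    pderiv3 (fun y => A y i) k x = fderiv ℝ A x (EuclideanSpace.single k 1) i := by
  have h := ((EuclideanSpace.proj (𝕜 := ℝ) i).hasFDerivAt (x := A x)).comp x hA.hasFDerivAt
  have h' : fderiv ℝ (fun y => A y i) x = (EuclideanSpace.proj (𝕜 := ℝ) i).comp (fderiv ℝ A x) :=
    h.fderiv
  rw [pderiv3, h']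
  rfl

/-- The energy density with weights `a`, `b` on its potential and magnetic parts, as a function of
the `1`-jet of `(u, A)`. -/
def jetDensity (a b : ℝ) (J : ℂ × E3 × (E3 →L[ℝ] ℂ) × (E3 →L[ℝ] E3)) : ℝ :=
  (1 / 2) * (∑ k : Fin 3, ‖J.2.2.1 (EuclideanSpace.single k 1)
      - Complex.I * (J.2.1 k : ℂ) * J.1‖ ^ 2)
  + a * (1 - ‖J.1‖ ^ 2) ^ 2
  + b * ((J.2.2.2 (EuclideanSpace.single 1 1) 2 - J.2.2.2 (EuclideanSpace.single 2 1) 1) ^ 2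
    + (J.2.2.2 (EuclideanSpace.single 2 1) 0 - J.2.2.2 (EuclideanSpace.single 0 1) 2) ^ 2
    + (J.2.2.2 (EuclideanSpace.single 0 1) 1 - J.2.2.2 (EuclideanSpace.single 1 1) 0) ^ 2)

lemma continuous_jetDensity (a b : ℝ) : Continuous (jetDensity a b) := by
  unfold jetDensity
  fun_prop

lemma norm_curl3_sq {A : E3 → E3} {x : E3} (hA : DifferentiableAt ℝ A x) :
    ‖curl3 A x‖ ^ 2 =
      (fderiv ℝ A x (EuclideanSpace.single 1 1) 2 - fderiv ℝ A x (EuclideanSpace.single 2 1) 1) ^ 2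
      + (fderiv ℝ A x (EuclideanSpace.single 2 1) 0
        - fderiv ℝ A x (EuclideanSpace.single 0 1) 2) ^ 2
      + (fderiv ℝ A x (EuclideanSpace.single 0 1) 1
        - fderiv ℝ A x (EuclideanSpace.single 1 1) 0) ^ 2 := by
  rw [EuclideanSpace.norm_sq_eq, Fin.sum_univ_three]
  simp [curl3, pderiv3_apply hA]

lemma eDensity3_nonneg (ε : ℝ) (u : E3 → ℂ) (A : E3 → E3) (x : E3) : 0 ≤ eDensity3 ε u A x := by
  unfold eDensity3
  positivity

lemma freeEnergy3_nonneg (ε : ℝ) (u : E3 → ℂ) (A : E3 → E3) (Ω : Set E3) :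
    0 ≤ freeEnergy3 ε u A Ω := by
  unfold freeEnergy3
  refine mul_nonneg (by norm_num) (integral_nonneg fun x => ?_)
  dsimp only [Pi.zero_apply]
  positivity

section Regularity

variable {Ω : Set E3} {u : E3 → ℂ} {A : E3 → E3}

lemma continuousOn_jet (hΩ : IsOpen Ω) (hu : ContDiffOn ℝ 1 u (closure Ω))
    (hA : ContDiffOn ℝ 1 A (closure Ω)) :
    ContinuousOn (fun x => (u x, A x, fderiv ℝ u x, fderiv ℝ A x)) Ω := by
  have hu' := hu.mono subset_closure
  have hA' := hA.mono subset_closure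
  exact hu'.continuousOn.prodMk (hA'.continuousOn.prodMk
    ((hu'.continuousOn_fderiv_of_isOpen hΩ le_rfl).prodMk
      (hA'.continuousOn_fderiv_of_isOpen hΩ le_rfl)))

lemma integrableOn_jetDensity (hΩ : IsOpen Ω) (hb : Bornology.IsBounded Ω)
    (hu : ContDiffOn ℝ 1 u (closure Ω)) (hA : ContDiffOn ℝ 1 A (closure Ω)) (a b : ℝ) :
    IntegrableOn (fun x => jetDensity a b (u x, A x, fderiv ℝ u x, fderiv ℝ A x)) Ω := by
  obtain ⟨M₁, h₁⟩ := hb.isCompact_closure.exists_bound_of_continuousOn hu.continuousOn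
  obtain ⟨M₂, h₂⟩ := hb.isCompact_closure.exists_bound_of_continuousOn hA.continuousOn
  obtain ⟨M₃, h₃⟩ := exists_norm_fderiv_le hΩ hb hu
  obtain ⟨M₄, h₄⟩ := exists_norm_fderiv_le hΩ hb hA
  have : ProperSpace (E3 →L[ℝ] ℂ) := FiniteDimensional.proper ℝ _
  have : ProperSpace (E3 →L[ℝ] E3) := FiniteDimensional.proper ℝ _
  obtain ⟨M, hM⟩ := (isCompact_closedBall (0 : ℂ × E3 × (E3 →L[ℝ] ℂ) × (E3 →L[ℝ] E3))
    (max M₁ (max M₂ (max M₃ M₄)))).exists_bound_of_continuousOn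
    (continuous_jetDensity a b).continuousOn
  have hm : AEStronglyMeasurable (fun x => jetDensity a b (u x, A x, fderiv ℝ u x, fderiv ℝ A x))
      (volume.restrict Ω) :=
    ((continuous_jetDensity a b).comp_continuousOn
      (continuousOn_jet hΩ hu hA)).aestronglyMeasurable hΩ.measurableSet
  refine IntegrableOn.of_bound hb.measure_lt_top hm M
    ((ae_restrict_iff' hΩ.measurableSet).2 (.of_forall fun x hx => hM _ ?_))
  rw [mem_closedBall_zero_iff]
  exact max_le_max (h₁ x (subset_closure hx)) (max_le_max (h₂ x (subset_closure hx))
    (max_le_max (h₃ x hx) (h₄ x hx)))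

lemma differentiableAt_of_contDiffOn_closure {F : Type*} [NormedAddCommGroup F] [NormedSpace ℝ F]
    {f : E3 → F} (hΩ : IsOpen Ω) (hf : ContDiffOn ℝ 1 f (closure Ω)) {x : E3} (hx : x ∈ Ω) :
    DifferentiableAt ℝ f x :=
  ((hf.mono subset_closure).contDiffAt (hΩ.mem_nhds hx)).differentiableAt one_ne_zero

lemma eDensity3_eq_jetDensity (hΩ : IsOpen Ω) (hA : ContDiffOn ℝ 1 A (closure Ω)) (ε : ℝ) {x : E3}
    (hx : x ∈ Ω) : eDensity3 ε u A x
      = jetDensity (1 / (4 * ε ^ 2)) 1 (u x, A x, fderiv ℝ u x, fderiv ℝ A x) := by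
  rw [eDensity3, jetDensity, norm_curl3_sq (differentiableAt_of_contDiffOn_closure hΩ hA hx)]
  ring

lemma measurable_indicator_eDensity3 (hΩ : IsOpen Ω) (hu : ContDiffOn ℝ 1 u (closure Ω))
    (hA : ContDiffOn ℝ 1 A (closure Ω)) (ε : ℝ) :
    Measurable (Ω.indicator fun x => ENNReal.ofReal (eDensity3 ε u A x)) := by
  have hc : ContinuousOn (fun x => ENNReal.ofReal (eDensity3 ε u A x)) Ω :=
    ENNReal.continuous_ofReal.comp_continuousOn
      (((continuous_jetDensity _ _).comp_continuousOn (continuousOn_jet hΩ hu hA)).congr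
        fun x hx => eDensity3_eq_jetDensity hΩ hA ε hx)
  classical
  exact hc.measurable_piecewise continuousOn_const hΩ.measurableSet

lemma lintegral_indicator_eDensity3_le (hΩ : IsOpen Ω) (hb : Bornology.IsBounded Ω)
    (hu : ContDiffOn ℝ 1 u (closure Ω)) (hA : ContDiffOn ℝ 1 A (closure Ω)) (ε : ℝ) :
    ∫⁻ x, Ω.indicator (fun x => ENNReal.ofReal (eDensity3 ε u A x)) x
      ≤ ENNReal.ofReal (2 * freeEnergy3 ε u A Ω) := by
  rw [lintegral_indicator hΩ.measurableSet]
  set f : E3 → ℝ := fun x => (∑ k : Fin 3, ‖fderiv ℝ u x (EuclideanSpace.single k 1)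
        - Complex.I * (A x k : ℂ) * u x‖ ^ 2)
      + (1 / (2 * ε ^ 2)) * (1 - ‖u x‖ ^ 2) ^ 2 + ‖curl3 A x‖ ^ 2 with hf
  have hf0 : ∀ x, 0 ≤ f x := fun x => by simp only [hf]; positivity
  have hint : IntegrableOn f Ω := by
    have h2 : IntegrableOn (fun x => 2 * jetDensity (1 / (4 * ε ^ 2)) (1 / 2)
        (u x, A x, fderiv ℝ u x, fderiv ℝ A x)) Ω :=
      (integrableOn_jetDensity hΩ hb hu hA _ _).const_mul 2
    refine h2.congr_fun (fun x hx => ?_) hΩ.measurableSet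
    simp only [hf]
    rw [jetDensity, norm_curl3_sq (differentiableAt_of_contDiffOn_closure hΩ hA hx)]
    ring
  have hF : 2 * freeEnergy3 ε u A Ω = ∫ x in Ω, f x := by
    rw [freeEnergy3]
    ring
  rw [hF, ofReal_integral_eq_lintegral_ofReal hint (.of_forall hf0)]
  refine lintegral_mono fun x => ENNReal.ofReal_le_ofReal ?_
  simp only [hf, eDensity3]
  have h1 : 0 ≤ ∑ k : Fin 3, ‖fderiv ℝ u x (EuclideanSpace.single k 1)
        - Complex.I * (A x k : ℂ) * u x‖ ^ 2 := by positivity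
  have h2 : 1 / (4 * ε ^ 2) * (1 - ‖u x‖ ^ 2) ^ 2 ≤ 1 / (2 * ε ^ 2) * (1 - ‖u x‖ ^ 2) ^ 2 := by
    have : 1 / (2 * ε ^ 2) = 2 * (1 / (4 * ε ^ 2)) := by ring
    rw [this]
    have : 0 ≤ 1 / (4 * ε ^ 2) * (1 - ‖u x‖ ^ 2) ^ 2 := by positivity
    linarith
  linarith

end Regularity

/-- A bounded smooth function of `|z|` vanishing exactly on the unit circle. -/
def wellDepth (z : ℂ) : ℝ := ((1 - ‖z‖ ^ 2) / (1 + ‖z‖ ^ 2)) ^ 2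

lemma continuous_wellDepth : Continuous wellDepth := by
  unfold wellDepth
  refine Continuous.pow (Continuous.div (by fun_prop) (by fun_prop) fun z => ?_) 2
  positivity

lemma wellDepth_nonneg (z : ℂ) : 0 ≤ wellDepth z := sq_nonneg _

lemma wellDepth_le (z : ℂ) : wellDepth z ≤ (1 - ‖z‖ ^ 2) ^ 2 := by
  rw [wellDepth, div_pow]
  refine div_le_self (sq_nonneg _) (one_le_pow₀ ?_)
  nlinarith [sq_nonneg ‖z‖]

lemma le_wellDepth_of_norm_le {z : ℂ} (hz : ‖z‖ ≤ 5 / 8) : 19 / 100 ≤ wellDepth z := by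
  have h0 := norm_nonneg z
  have h1 : ‖z‖ ^ 2 ≤ 25 / 64 := by nlinarith
  have h2 : 39 / 89 ≤ (1 - ‖z‖ ^ 2) / (1 + ‖z‖ ^ 2) := by
    rw [le_div_iff₀ (by positivity)]
    linarith
  rw [wellDepth]
  nlinarith

lemma exists_hasDerivAt_wellDepth {c : ℝ → ℂ} {c' : ℂ} {s : ℝ} (hc : HasDerivAt c c' s) (a : ℝ) :
    ∃ D : ℝ, HasDerivAt (fun t => wellDepth (c t)) D s ∧
      |D| ≤ 4 * |1 - ‖c s‖ ^ 2| * ‖c' - Complex.I * (a : ℂ) * c s‖ := by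
  set z := c s with hz
  set q := ‖z‖ ^ 2 with hq
  set d := c' - Complex.I * (a : ℂ) * z with hd
  have hq0 : 0 ≤ q := sq_nonneg _
  have hinner : inner ℝ z c' = inner ℝ z d := by
    simp only [hd, Complex.inner]
    simp
    ring
  have hnq : HasDerivAt (fun t => ‖c t‖ ^ 2) (2 * inner ℝ z c') s := hc.norm_sq
  have hder := (((hasDerivAt_const s (1 : ℝ)).sub hnq).div
    ((hasDerivAt_const s (1 : ℝ)).add hnq) (show 1 + ‖c s‖ ^ 2 ≠ 0 by positivity)).pow 2
  refine ⟨_, hder, ?_⟩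
  have habs : |inner ℝ z d| ≤ ‖z‖ * ‖d‖ := abs_real_inner_le_norm z d
  simp only [Pi.sub_apply, Pi.add_apply, ← hz, ← hq, hinner]
  have heq : ((2 : ℕ) : ℝ) * ((1 - q) / (1 + q)) ^ (2 - 1) *
      (((0 - 2 * inner ℝ z d) * (1 + q) - (1 - q) * (0 + 2 * inner ℝ z d)) / (1 + q) ^ 2)
      = 4 * (1 - q) * (-(2 * inner ℝ z d) / (1 + q) ^ 3) := by
    have hq1 : 1 + q ≠ 0 := by positivity
    rw [Nat.add_one_sub_one, pow_one, Nat.cast_ofNat]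
    field_simp
    ring
  have hfrac : |-(2 * inner ℝ z d) / (1 + q) ^ 3| ≤ ‖d‖ := by
    rw [abs_div, abs_neg, abs_of_pos (by positivity : 0 < (1 + q) ^ 3),
      div_le_iff₀ (by positivity), abs_mul, abs_two]
    have h1 : 2 * ‖z‖ ≤ (1 + q) ^ 3 := by
      have : 2 * ‖z‖ ≤ 1 + q := by nlinarith [sq_nonneg (‖z‖ - 1)]
      refine this.trans (le_self_pow₀ (by linarith) (by norm_num))
    nlinarith [norm_nonneg d]
  refine (congrArg abs heq).trans_le ?_
  rw [abs_mul, abs_mul, abs_of_pos (by norm_num : (0 : ℝ) < 4)]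
  gcongr

lemma norm_covariant_sq_le (u : E3 → ℂ) (A : E3 → E3) (x : E3) {v : E3} (hv : ‖v‖ = 1) :
    ‖fderiv ℝ u x v - Complex.I * ((∑ k, A x k * v k : ℝ) : ℂ) * u x‖ ^ 2 ≤
      ∑ k : Fin 3, ‖fderiv ℝ u x (EuclideanSpace.single k 1)
        - Complex.I * (A x k : ℂ) * u x‖ ^ 2 := by
  set D : Fin 3 → ℂ := fun k => fderiv ℝ u x (EuclideanSpace.single k 1)
        - Complex.I * (A x k : ℂ) * u x with hD
  have hvs : v = ∑ k, v k • EuclideanSpace.single k (1 : ℝ) := by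
    ext i
    fin_cases i <;> simp [Fin.sum_univ_three]
  have hsum : fderiv ℝ u x v - Complex.I * ((∑ k, A x k * v k : ℝ) : ℂ) * u x
      = ∑ k, (v k : ℂ) * D k := by
    conv_lhs => rw [hvs]
    simp only [hD, Fin.sum_univ_three]
    simp
    ring
  rw [hsum]
  have h1 : ‖∑ k, (v k : ℂ) * D k‖ ≤ ∑ k, ‖v k‖ * ‖D k‖ :=
    (norm_sum_le _ _).trans (le_of_eq (by simp))
  have h2 : (∑ k, ‖v k‖ * ‖D k‖) ^ 2 ≤ (∑ k, ‖v k‖ ^ 2) * ∑ k, ‖D k‖ ^ 2 :=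
    Finset.sum_mul_sq_le_sq_mul_sq _ _ _
  rw [← EuclideanSpace.norm_sq_eq, hv, one_pow, one_mul] at h2
  exact (pow_le_pow_left₀ (norm_nonneg _) h1 2).trans h2

lemma wellDepth_le_mul_eDensity3 {ε : ℝ} (hε : 0 < ε) (u : E3 → ℂ) (A : E3 → E3) (x : E3) :
    wellDepth (u x) ≤ 4 * ε ^ 2 * eDensity3 ε u A x := by
  refine (wellDepth_le _).trans ?_
  rw [eDensity3]
  have h1 : 0 ≤ ∑ k : Fin 3, ‖fderiv ℝ u x (EuclideanSpace.single k 1)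
        - Complex.I * (A x k : ℂ) * u x‖ ^ 2 := by positivity
  have h2 : 4 * ε ^ 2 * (1 / (4 * ε ^ 2) * (1 - ‖u x‖ ^ 2) ^ 2) = (1 - ‖u x‖ ^ 2) ^ 2 := by
    field_simp
  have h3 : 0 < 4 * ε ^ 2 := by positivity
  nlinarith [sq_nonneg ‖curl3 A x‖]

lemma mul_covariant_le_mul_eDensity3 {ε : ℝ} (hε : 0 < ε) (u : E3 → ℂ) (A : E3 → E3) (x : E3)
    {d : ℝ} (hd : d ^ 2 ≤ ∑ k : Fin 3, ‖fderiv ℝ u x (EuclideanSpace.single k 1)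
        - Complex.I * (A x k : ℂ) * u x‖ ^ 2) :
    4 * |1 - ‖u x‖ ^ 2| * d ≤ 6 * ε * eDensity3 ε u A x := by
  rw [eDensity3]
  set m := |1 - ‖u x‖ ^ 2| with hm
  have hm2 : (1 - ‖u x‖ ^ 2) ^ 2 = m ^ 2 := (sq_abs _).symm
  have h1 : 6 * ε * (1 / (4 * ε ^ 2) * (1 - ‖u x‖ ^ 2) ^ 2) = (3 / 2) * (m ^ 2 / ε) := by
    rw [hm2]; field_simp; ring
  have h2 : 4 * m * d ≤ 3 * ε * d ^ 2 + (3 / 2) * (m ^ 2 / ε) := by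
    have h3 : m * d * 4 * ε ≤ 3 * (ε * d) ^ 2 + (3 / 2) * m ^ 2 := by
      nlinarith [sq_nonneg (3 * (ε * d) - 2 * m), sq_nonneg m]
    have h4 : 3 * ε * d ^ 2 + (3 / 2) * (m ^ 2 / ε)
        = (3 * (ε * d) ^ 2 + (3 / 2) * m ^ 2) / ε := by field_simp
    rw [h4, le_div_iff₀ hε]
    linarith
  nlinarith [sq_nonneg ‖curl3 A x‖]

section Segments

variable {Ω : Set E3} {u : E3 → ℂ} {A : E3 → E3} {ε : ℝ}

lemma mem_closure_of_segment {x v : E3} {l : ℝ} (hl : 0 < l)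
    (h : ∀ s ∈ Set.Ioo 0 l, x + s • v ∈ Ω) : ∀ s ∈ Set.Icc 0 l, x + s • v ∈ closure Ω := by
  rw [← closure_Ioo hl.ne]
  intro s hs
  have hc : ContinuousOn (fun s : ℝ => x + s • v) (closure (Set.Ioo 0 l)) := by fun_prop
  exact closure_mono (Set.image_subset_iff.2 h) (hc.image_closure ⟨s, hs, rfl⟩)

/-- The oscillation of `wellDepth ∘ u` along a segment inside `Ω` is controlled by `6 ε` times the
energy on that segment. -/
lemma wellDepth_oscillation_le (hΩ : IsOpen Ω) (hu : ContDiffOn ℝ 1 u (closure Ω)) (hε : 0 < ε)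
    {x v : E3} (hv : ‖v‖ = 1) {l : ℝ} (hl : 0 < l) (h : ∀ s ∈ Set.Ioo 0 l, x + s • v ∈ Ω) :
    ENNReal.ofReal |wellDepth (u (x + l • v)) - wellDepth (u x)| ≤
      ENNReal.ofReal (6 * ε) * ∫⁻ s in Set.Ioo 0 l,
        Ω.indicator (fun y => ENNReal.ofReal (eDensity3 ε u A y)) (x + s • v) := by
  have hline : ∀ s : ℝ, HasDerivAt (fun s : ℝ => x + s • v) v s := fun s => by
    simpa using ((hasDerivAt_id s).smul_const v).const_add x
  have hder : ∀ s ∈ Set.Ioo 0 l, ∃ D : ℝ,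
      HasDerivAt (fun s => wellDepth (u (x + s • v))) D s ∧
      |D| ≤ 6 * ε * eDensity3 ε u A (x + s • v) := fun s hs => by
    have hc : HasDerivAt (fun s : ℝ => u (x + s • v)) (fderiv ℝ u (x + s • v) v) s :=
      (differentiableAt_of_contDiffOn_closure hΩ hu (h s hs)).hasFDerivAt.comp_hasDerivAt s
        (hline s)
    obtain ⟨D, hD, hle⟩ := exists_hasDerivAt_wellDepth hc (∑ k, A (x + s • v) k * v k)
    exact ⟨D, hD, hle.trans
      (mul_covariant_le_mul_eDensity3 hε u A _ (norm_covariant_sq_le u A _ hv))⟩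
  choose! D hD hDle using hder
  have hcont : ContinuousOn (fun s => wellDepth (u (x + s • v))) (Set.Icc 0 l) :=
    continuous_wellDepth.comp_continuousOn
      (hu.continuousOn.comp (by fun_prop) (mem_closure_of_segment hl h))
  have hftc := ofReal_abs_sub_le_setLIntegral hl.le hcont hD
    (G := fun s => ENNReal.ofReal (6 * ε) *
      Ω.indicator (fun y => ENNReal.ofReal (eDensity3 ε u A y)) (x + s • v)) fun s hs => by
    rw [Set.indicator_of_mem (h s hs), ← ENNReal.ofReal_mul (by positivity)]
    exact ENNReal.ofReal_le_ofReal (hDle s hs)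
  rw [lintegral_const_mul' _ _ ENNReal.ofReal_ne_top] at hftc
  simpa using hftc

lemma segmentMassBound_wellDepth (hΩ : IsOpen Ω) (hu : ContDiffOn ℝ 1 u (closure Ω)) (hε : 0 < ε)
    (hε1 : ε ≤ 1) :
    SegmentMassBound Ω {x | x ∈ frontier Ω ∧ 1 / 10 ≤ wellDepth (u x)}
      (fun x => ENNReal.ofReal (100 * ε) *
        Ω.indicator (fun y => ENNReal.ofReal (eDensity3 ε u A y)) x) := by
  rintro x ⟨-, hx⟩ v hv l hl hl1 h
  set H := Ω.indicator (fun y => ENNReal.ofReal (eDensity3 ε u A y)) with hH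
  set I := ∫⁻ s in Set.Ioo 0 l, H (x + s • v) with hI
  have hpt : ∀ s ∈ Set.Ioo 0 l, ENNReal.ofReal (1 / 10) ≤
      ENNReal.ofReal (4 * ε) * H (x + s • v) + ENNReal.ofReal (6 * ε) * I := fun s hs => by
    have h1 := wellDepth_oscillation_le (A := A) hΩ hu hε hv hs.1
      fun t ht => h t ⟨ht.1, ht.2.trans hs.2⟩
    have h2 : ∫⁻ t in Set.Ioo 0 s, H (x + t • v) ≤ I :=
      lintegral_mono_set (Set.Ioo_subset_Ioo_right hs.2.le)
    have h3 : ENNReal.ofReal (wellDepth (u (x + s • v))) ≤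
        ENNReal.ofReal (4 * ε) * H (x + s • v) := by
      rw [hH, Set.indicator_of_mem (h s hs), ← ENNReal.ofReal_mul (by positivity)]
      refine ENNReal.ofReal_le_ofReal ((wellDepth_le_mul_eDensity3 hε u A _).trans ?_)
      have : ε ^ 2 ≤ ε := by nlinarith
      have := eDensity3_nonneg ε u A (x + s • v)
      gcongr
    calc ENNReal.ofReal (1 / 10)
        ≤ ENNReal.ofReal (wellDepth (u (x + s • v)) +
            |wellDepth (u (x + s • v)) - wellDepth (u x)|) := by
          refine ENNReal.ofReal_le_ofReal ?_
          have := neg_abs_le (wellDepth (u (x + s • v)) - wellDepth (u x))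
          linarith
      _ = ENNReal.ofReal (wellDepth (u (x + s • v))) +
            ENNReal.ofReal |wellDepth (u (x + s • v)) - wellDepth (u x)| :=
          ENNReal.ofReal_add (wellDepth_nonneg _) (abs_nonneg _)
      _ ≤ _ := add_le_add h3 (h1.trans (by gcongr))
  have hint : ENNReal.ofReal l * ENNReal.ofReal (1 / 10) ≤ ENNReal.ofReal (10 * ε) * I := by
    calc ENNReal.ofReal l * ENNReal.ofReal (1 / 10)
        = ∫⁻ _ in Set.Ioo 0 l, ENNReal.ofReal (1 / 10) := by
          rw [setLIntegral_const, Real.volume_Ioo, sub_zero, mul_comm]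
      _ ≤ ∫⁻ s in Set.Ioo 0 l,
            (ENNReal.ofReal (4 * ε) * H (x + s • v) + ENNReal.ofReal (6 * ε) * I) :=
          setLIntegral_mono' measurableSet_Ioo hpt
      _ = ENNReal.ofReal (4 * ε) * I + ENNReal.ofReal (6 * ε) * I * ENNReal.ofReal l := by
          rw [lintegral_add_right _ measurable_const, setLIntegral_const, Real.volume_Ioo, sub_zero,
            lintegral_const_mul' _ _ ENNReal.ofReal_ne_top]
      _ ≤ ENNReal.ofReal (4 * ε) * I + ENNReal.ofReal (6 * ε) * I * 1 := by
          gcongr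
          simpa using hl1
      _ = ENNReal.ofReal (10 * ε) * I := by
          rw [mul_one, ← add_mul, ← ENNReal.ofReal_add (by positivity) (by positivity)]
          congr 2
          ring
  rw [lintegral_const_mul' _ _ ENNReal.ofReal_ne_top]
  calc ENNReal.ofReal l = 10 * (ENNReal.ofReal l * ENNReal.ofReal (1 / 10)) := by
        rw [← ENNReal.ofReal_mul hl.le, ← ENNReal.ofReal_ofNat 10,
          ← ENNReal.ofReal_mul (by norm_num)]
        congr 1
        ring
    _ ≤ 10 * (ENNReal.ofReal (10 * ε) * I) := by gcongr
    _ = ENNReal.ofReal (100 * ε) * I := by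
        rw [← mul_assoc, ← ENNReal.ofReal_ofNat 10, ← ENNReal.ofReal_mul (by norm_num)]
        congr 2
        ring

/-- A ray starting inside a bounded open set leaves it through a boundary point. -/
lemma exists_exit (hΩ : IsOpen Ω) (hb : Bornology.IsBounded Ω) {x v : E3} (hx : x ∈ Ω)
    (hv : ‖v‖ = 1) : ∃ l : ℝ, 0 < l ∧ x + l • v ∈ frontier Ω ∧ ∀ s ∈ Set.Ioo 0 l, x + s • v ∈ Ω := by
  set T : Set ℝ := {s | 0 ≤ s ∧ x + s • v ∉ Ω} with hT
  have hcont : Continuous fun s : ℝ => x + s • v := by fun_prop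
  have hTc : IsClosed T := isClosed_Ici.inter (hΩ.isClosed_compl.preimage hcont)
  have hne : T.Nonempty := by
    obtain ⟨R, hR⟩ := hb.subset_closedBall x
    refine ⟨|R| + 1, by positivity, fun hmem => ?_⟩
    have := hR hmem
    rw [mem_closedBall, dist_eq_norm, add_sub_cancel_left, norm_smul, hv, mul_one,
      Real.norm_of_nonneg (by positivity)] at this
    linarith [le_abs_self R]
  have hbdd : BddBelow T := ⟨0, fun s hs => hs.1⟩
  have hmem := hTc.csInf_mem hne hbdd
  set l := sInf T with hl
  have hin : ∀ s ∈ Set.Ioo 0 l, x + s • v ∈ Ω := fun s hs => by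
    by_contra hns
    exact absurd (csInf_le hbdd ⟨hs.1.le, hns⟩) (not_le.2 hs.2)
  have hl0 : 0 < l := by
    refine lt_of_le_of_ne hmem.1 fun h0 => hmem.2 ?_
    rw [← h0]
    simpa using hx
  refine ⟨l, hl0, ?_, hin⟩
  rw [hΩ.frontier_eq]
  exact ⟨mem_closure_of_segment hl0 hin l ⟨hl0.le, le_rfl⟩, hmem.2⟩

end Segments

lemma exists_line_subset_latticeEdges {δ : ℝ} {y : E3} (hy : y ∈ latticeEdges δ) :
    ∃ k : Fin 3, ∀ t : ℝ, y + t • EuclideanSpace.single k (1 : ℝ) ∈ latticeEdges δ := by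
  obtain ⟨i, j, hij, ⟨z, hz⟩, ⟨w, hw⟩⟩ := hy
  obtain ⟨k, hki, hkj⟩ : ∃ k, i ≠ k ∧ j ≠ k := by
    clear hz hw; revert i j; decide
  exact ⟨k, fun t => ⟨i, j, hij, ⟨z, by simp [hki, hz]⟩, ⟨w, by simp [hkj, hw]⟩⟩⟩

/-- Projection along the `k`-th coordinate axis. -/
def projAlong (k : Fin 3) (x : E3) : Fin 2 → ℝ := fun j => x (k.succAbove j)

lemma lipschitzWith_projAlong (k : Fin 3) : LipschitzWith 1 (projAlong k) := by
  refine LipschitzWith.of_dist_le_mul fun x y => ?_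
  rw [NNReal.coe_one, one_mul]
  refine (dist_pi_le_iff dist_nonneg).2 fun j => ?_
  rw [dist_eq_norm x y, Real.dist_eq]
  exact PiLp.norm_apply_le (x - y) _

/-- The piece of height one of the cylinder over `S` in the `k`-th coordinate direction. -/
def cylinderAlong (k : Fin 3) (S : Set E3) : Set E3 :=
  {x | x k ∈ Set.Icc 0 1 ∧ projAlong k x ∈ projAlong k '' S}

lemma measurableSet_cylinderAlong (k : Fin 3) {S : Set E3} (hS : IsCompact S) :
    MeasurableSet (cylinderAlong k S) := by
  have h1 : Continuous fun x : E3 => x k := by fun_prop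
  exact (measurableSet_Icc.preimage h1.measurable).inter
    ((hS.image (lipschitzWith_projAlong k).continuous).measurableSet.preimage
      (lipschitzWith_projAlong k).continuous.measurable)

lemma volume_cylinderAlong_le (k : Fin 3) {S : Set E3} (hS : IsCompact S) :
    volume (cylinderAlong k S) ≤ μH[2] S := by
  have hmp := (volume_preserving_piFinSuccAbove (fun _ : Fin 3 => ℝ) k).comp
    (PiLp.volume_preserving_ofLp (Fin 3))
  have hSm := (hS.image (lipschitzWith_projAlong k).continuous).measurableSet
  have hvol : (μH[2] : Measure (Fin 2 → ℝ)) = volume := by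
    simpa using hausdorffMeasure_pi_real (ι := Fin 2)
  calc volume (cylinderAlong k S)
      = volume (Set.Icc (0 : ℝ) 1 ×ˢ (projAlong k '' S)) :=
        hmp.measure_preimage (measurableSet_Icc.prod hSm).nullMeasurableSet
    _ = μH[2] (projAlong k '' S) := by
        rw [Measure.volume_eq_prod, Measure.prod_prod, hvol]
        simp
    _ ≤ μH[2] S := by
        simpa using (lipschitzWith_projAlong k).hausdorffMeasure_image_le zero_le_two S

lemma one_le_lintegral_cylinderAlong {δ : ℝ} {S : Set E3} (hS : IsCompact S) {b y : E3}
    (hyS : b + y ∈ S) {k : Fin 3}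
    (hk : ∀ t : ℝ, y + t • EuclideanSpace.single k (1 : ℝ) ∈ latticeEdges δ) :
    1 ≤ ∫⁻ z in latticeEdges δ, (cylinderAlong k S).indicator 1 (b + z) ∂μH[1] := by
  have hm : MeasurableSet ((fun z => b + z) ⁻¹' cylinderAlong k S) :=
    (measurableSet_cylinderAlong k hS).preimage (measurable_const_add b)
  have hind : (fun z => (cylinderAlong k S).indicator (1 : E3 → ℝ≥0∞) (b + z))
      = ((fun z => b + z) ⁻¹' cylinderAlong k S).indicator 1 := by
    rfl
  rw [hind, lintegral_indicator_one hm, Measure.restrict_apply hm]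
  have himg := (isometry_add_sub_smul_single y ((b + y) k) k).hausdorffMeasure_image
    (Or.inl zero_le_one) (Set.Icc (0 : ℝ) 1)
  rw [hausdorffMeasure_real, Real.volume_Icc, sub_zero, ENNReal.ofReal_one] at himg
  rw [← himg]
  refine measure_mono ?_
  rintro _ ⟨t, ht, rfl⟩
  refine ⟨⟨?_, b + y, hyS, ?_⟩, hk _⟩
  · have : (b + (y + (t - (b + y) k) • EuclideanSpace.single k (1 : ℝ))) k = t := by
      simp only [PiLp.add_apply, PiLp.smul_apply, PiLp.single_apply, if_true, smul_eq_mul]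
      ring
    rwa [this]
  · ext j
    simp [projAlong]

/-- The set of translations in a cube for which the edges of the grid meet a compact set `S`
has volume at most `9 δ` times the area of `S`. -/
lemma volume_edges_hit_le {δ : ℝ} (hδ : 0 < δ) (a : E3) {S : Set E3} (hS : IsCompact S) :
    volume ({b : E3 | ∃ y ∈ latticeEdges δ, b + y ∈ S} ∩
      {b : E3 | ∀ i, b i ∈ Set.Ico (a i) (a i + δ)}) ≤ 9 * ENNReal.ofReal δ * μH[2] S := by
  set Q : Set E3 := {b : E3 | ∀ i, b i ∈ Set.Ico (a i) (a i + δ)}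
  let f : Fin 3 → E3 → ℝ≥0∞ := fun k b =>
    ∫⁻ z in latticeEdges δ, (cylinderAlong k S).indicator 1 (b + z) ∂μH[1]
  have hsub : {b : E3 | ∃ y ∈ latticeEdges δ, b + y ∈ S} ⊆ ⋃ k, {b | 1 ≤ f k b} := by
    rintro b ⟨y, hy, hyS⟩
    obtain ⟨k, hk⟩ := exists_line_subset_latticeEdges hy
    exact Set.mem_iUnion.2 ⟨k, one_le_lintegral_cylinderAlong hS hyS hk⟩
  have hk : ∀ k, volume.restrict Q {b | 1 ≤ f k b} ≤ 3 * ENNReal.ofReal δ * μH[2] S := fun k => by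
    have hNm := measurableSet_cylinderAlong k hS
    obtain ⟨hm, hle⟩ := lintegral_cell_lintegral_translate_le hδ
      (ENNReal.mul_ne_top ENNReal.ofNat_ne_top ENNReal.ofReal_ne_top)
      (hausdorffMeasure_latticeEdges_inter_cell_le hδ) a
      (measurable_one.indicator hNm : Measurable ((cylinderAlong k S).indicator (1 : E3 → ℝ≥0∞)))
    rw [lintegral_indicator_one hNm] at hle
    have hmarkov := meas_ge_le_lintegral_div (μ := volume.restrict Q) hm.aemeasurable one_ne_zero
      ENNReal.one_ne_top
    rw [div_one] at hmarkov
    refine hmarkov.trans (hle.trans ?_)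
    exact mul_le_mul_right (volume_cylinderAlong_le k hS) _
  calc volume ({b : E3 | ∃ y ∈ latticeEdges δ, b + y ∈ S} ∩ Q)
      ≤ volume.restrict Q {b : E3 | ∃ y ∈ latticeEdges δ, b + y ∈ S} := Measure.le_restrict_apply _ _
    _ ≤ ∑' k, volume.restrict Q {b | 1 ≤ f k b} :=
        (measure_mono hsub).trans (measure_iUnion_le _)
    _ ≤ ∑' _ : Fin 3, 3 * ENNReal.ofReal δ * μH[2] S := ENNReal.tsum_le_tsum hk
    _ = 9 * ENNReal.ofReal δ * μH[2] S := by
        rw [tsum_fintype]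
        simp [← mul_assoc]; norm_num

lemma measure_four_mul_lt_le {α : Type*} [MeasurableSpace α] {μ : Measure α} {f : α → ℝ≥0∞}
    (hf : AEMeasurable f μ) {V m : ℝ≥0∞} (hm : m ≠ ∞) (h : ∫⁻ x, f x ∂μ ≤ V * m) :
    μ {x | 4 * m < f x} ≤ V / 4 := by
  rcases eq_or_ne m 0 with rfl | hm0
  · rw [mul_zero, nonpos_iff_eq_zero, lintegral_eq_zero_iff' hf] at h
    have : μ {x | 4 * 0 < f x} = 0 := by
      refine measure_mono_null (fun x hx => ?_) (ae_iff.1 h)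
      have hx' : 4 * 0 < f x := hx
      simpa using hx'.ne'
    rw [this]
    exact zero_le
  · calc μ {x | 4 * m < f x} ≤ μ {x | 4 * m ≤ f x} := 
          measure_mono fun x (hx : 4 * m < f x) => show 4 * m ≤ f x from hx.le
      _ ≤ (∫⁻ x, f x ∂μ) / (4 * m) :=
          meas_ge_le_lintegral_div hf (by simpa using hm0)
            (ENNReal.mul_ne_top ENNReal.ofNat_ne_top hm)
      _ ≤ V * m / (4 * m) := by gcongr
      _ = V / 4 := ENNReal.mul_div_mul_right _ _ hm0 hm

lemma volume_halfOpen_cube {δ : ℝ} (hδ : 0 < δ) (a : E3) :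
    volume {b : E3 | ∀ i, b i ∈ Set.Ico (a i) (a i + δ)} = ENNReal.ofReal (δ ^ 3) := by
  have h := (PiLp.volume_preserving_ofLp (Fin 3)).measure_preimage
    (s := Set.univ.pi fun i => Set.Ico (a i) (a i + δ))
    (MeasurableSet.univ_pi fun _ => measurableSet_Ico).nullMeasurableSet
  have hset : {b : E3 | ∀ i, b i ∈ Set.Ico (a i) (a i + δ)} =
      WithLp.ofLp ⁻¹' (Set.univ.pi fun i => Set.Ico (a i) (a i + δ)) := by
    ext b; simp
  rw [hset, h, Real.volume_pi_Ico, ENNReal.ofReal_pow hδ.le]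
  simp

/-- Selection of a translation of the grid: some `b` in a cube of side `δ` makes the integrals of
`H` over the edges and over the faces at most a multiple of their averages, while the edges avoid a
compact set of small area. -/
lemma exists_good_translation {δ F : ℝ} (hδ : 0 < δ) (_hF : 0 ≤ F) (a : E3) {S : Set E3}
    (hS : IsCompact S) (hSsmall : 9 * ENNReal.ofReal δ * μH[2] S ≤ ENNReal.ofReal (δ ^ 3 / 4))
    {H : E3 → ℝ≥0∞} (hH : Measurable H) (hHF : ∫⁻ x, H x ≤ ENNReal.ofReal (2 * F)) :
    ∃ b : E3, (∀ i, b i ∈ Set.Ico (a i) (a i + δ)) ∧ (∀ y ∈ latticeEdges δ, b + y ∉ S) ∧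
      ∫⁻ y in latticeEdges δ, H (b + y) ∂μH[1] ≤ ENNReal.ofReal (24 * (δ ^ 2)⁻¹ * F) ∧
      ∫⁻ y in latticeFaces δ, H (b + y) ∂μH[2] ≤ ENNReal.ofReal (72 * δ⁻¹ * F) := by
  set Q : Set E3 := {b : E3 | ∀ i, b i ∈ Set.Ico (a i) (a i + δ)} with hQ
  set V := ENNReal.ofReal (δ ^ 3) with hV
  have hV4 : V / 4 = ENNReal.ofReal (δ ^ 3 / 4) := by
    rw [ENNReal.ofReal_div_of_pos (by norm_num), ENNReal.ofReal_ofNat]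
  obtain ⟨hm₁, hle₁⟩ := lintegral_cell_lintegral_translate_le hδ
    (ENNReal.mul_ne_top ENNReal.ofNat_ne_top ENNReal.ofReal_ne_top)
    (hausdorffMeasure_latticeEdges_inter_cell_le hδ) a hH
  obtain ⟨hm₂, hle₂⟩ := lintegral_cell_lintegral_translate_le hδ
    (ENNReal.mul_ne_top ENNReal.ofNat_ne_top ENNReal.ofReal_ne_top)
    (hausdorffMeasure_latticeFaces_inter_cell_le hδ) a hH
  have hbad₁ := measure_four_mul_lt_le (μ := volume.restrict Q) (V := V)
    (m := ENNReal.ofReal (6 * (δ ^ 2)⁻¹ * F)) hm₁.aemeasurable ENNReal.ofReal_ne_top (by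
      refine (hle₁.trans (mul_le_mul_right hHF _)).trans (le_of_eq ?_)
      rw [hV, ← ENNReal.ofReal_ofNat 3, ← ENNReal.ofReal_mul (by norm_num),
        ← ENNReal.ofReal_mul (by positivity), ← ENNReal.ofReal_mul (by positivity)]
      congr 1
      field_simp
      ring)
  have hbad₂ := measure_four_mul_lt_le (μ := volume.restrict Q) (V := V)
    (m := ENNReal.ofReal (18 * δ⁻¹ * F)) hm₂.aemeasurable ENNReal.ofReal_ne_top (by
      refine (hle₂.trans (mul_le_mul_right hHF _)).trans (le_of_eq ?_)
      rw [hV, ← ENNReal.ofReal_ofNat 9, ← ENNReal.ofReal_mul (by norm_num),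
        ← ENNReal.ofReal_mul (by positivity), ← ENNReal.ofReal_mul (by positivity)]
      congr 1
      field_simp
      ring)
  have hbad₃ := (volume_edges_hit_le hδ a hS).trans hSsmall
  rw [← ENNReal.ofReal_ofNat 4, ← ENNReal.ofReal_mul (by norm_num), ENNReal.ofReal_ofNat 4, hV4]
    at hbad₁ hbad₂
  by_contra hcon
  push Not at hcon
  have hcover : Q ⊆ ({b | ENNReal.ofReal (4 * (6 * (δ ^ 2)⁻¹ * F)) <
        ∫⁻ y in latticeEdges δ, H (b + y) ∂μH[1]} ∩ Q ∪
      {b | ENNReal.ofReal (4 * (18 * δ⁻¹ * F)) <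
        ∫⁻ y in latticeFaces δ, H (b + y) ∂μH[2]} ∩ Q) ∪
      {b : E3 | ∃ y ∈ latticeEdges δ, b + y ∈ S} ∩ Q := by
    intro b hb
    by_cases h3 : ∃ y ∈ latticeEdges δ, b + y ∈ S
    · exact Or.inr ⟨h3, hb⟩
    push Not at h3
    by_cases h1 : ∫⁻ y in latticeEdges δ, H (b + y) ∂μH[1] ≤ ENNReal.ofReal (24 * (δ ^ 2)⁻¹ * F)
    · refine Or.inl (Or.inr ⟨?_, hb⟩)
      have h2 := hcon b hb h3 h1
      rwa [show 72 * δ⁻¹ * F = 4 * (18 * δ⁻¹ * F) by ring] at h2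
    · refine Or.inl (Or.inl ⟨?_, hb⟩)
      rw [not_le] at h1
      rwa [show 24 * (δ ^ 2)⁻¹ * F = 4 * (6 * (δ ^ 2)⁻¹ * F) by ring] at h1
  have hvol : ENNReal.ofReal (δ ^ 3) ≤ ENNReal.ofReal (δ ^ 3 / 4) + ENNReal.ofReal (δ ^ 3 / 4)
      + ENNReal.ofReal (δ ^ 3 / 4) := by
    rw [← volume_halfOpen_cube hδ a]
    refine (measure_mono hcover).trans ((measure_union_le _ _).trans (add_le_add
      ((measure_union_le _ _).trans (add_le_add ?_ ?_)) hbad₃))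
    · exact (Measure.le_restrict_apply _ _).trans hbad₁
    · exact (Measure.le_restrict_apply _ _).trans hbad₂
  have h4 : 0 ≤ δ ^ 3 / 4 := by positivity
  rw [← ENNReal.ofReal_add h4 h4, ← ENNReal.ofReal_add (by positivity) h4,
    ENNReal.ofReal_le_ofReal_iff (by positivity)] at hvol
  have : 0 < δ ^ 3 := by positivity
  linarith

lemma lintegral_segment_le_lintegral_latticeEdges {δ : ℝ} {H : E3 → ℝ≥0∞} (hH : Measurable H)
    {b y : E3} {k : Fin 3}
    (hk : ∀ t : ℝ, y + t • EuclideanSpace.single k (1 : ℝ) ∈ latticeEdges δ) (I : Set ℝ) :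
    ∫⁻ s in I, H (b + y + s • EuclideanSpace.single k (1 : ℝ)) ≤
      ∫⁻ z in latticeEdges δ, H (b + z) ∂μH[1] := by
  set φ : ℝ → E3 := fun s => y + s • EuclideanSpace.single k (1 : ℝ) with hφ
  have hiso : Isometry φ := by simpa using isometry_add_sub_smul_single y 0 k
  have hHb : Measurable fun z => H (b + z) := hH.comp (measurable_const_add b)
  have hmap := hiso.map_hausdorffMeasure (d := 1) (Or.inl zero_le_one)
  rw [hausdorffMeasure_real] at hmap
  calc ∫⁻ s in I, H (b + y + s • EuclideanSpace.single k (1 : ℝ))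
      ≤ ∫⁻ s, H (b + y + s • EuclideanSpace.single k (1 : ℝ)) := setLIntegral_le_lintegral _ _
    _ = ∫⁻ s, H (b + φ s) := by simp only [hφ, add_assoc]
    _ = ∫⁻ z in Set.range φ, H (b + z) ∂μH[1] := by
        rw [← hmap, lintegral_map hHb hiso.continuous.measurable]
    _ ≤ ∫⁻ z in latticeEdges δ, H (b + z) ∂μH[1] :=
        lintegral_mono_set (Set.range_subset_iff.2 hk)

lemma integral_translate_inter_le {d M : ℝ} (hM : 0 ≤ M) {L Ω : Set E3} (hΩ : IsOpen Ω) {b : E3}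
    {e : E3 → ℝ} (he : ∀ x, 0 ≤ e x)
    (h : ∫⁻ y in L, Ω.indicator (fun x => ENNReal.ofReal (e x)) (b + y) ∂μH[d]
      ≤ ENNReal.ofReal M) :
    ∫ x in ((fun y => b + y) '' L) ∩ Ω, e x ∂μH[d] ≤ M := by
  have hmp := (IsometryEquiv.addLeft b).measurePreserving_hausdorffMeasure d
  have h1 := hmp.setLIntegral_comp_emb (IsometryEquiv.addLeft b).toHomeomorph.measurableEmbedding
    (Ω.indicator fun x => ENNReal.ofReal (e x)) L
  simp only [IsometryEquiv.addLeft_apply] at h1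
  have h2 : ∫⁻ x in ((fun y => b + y) '' L) ∩ Ω, ENNReal.ofReal (e x) ∂μH[d] ≤
      ENNReal.ofReal M := by
    rw [Set.inter_comm, ← setLIntegral_indicator hΩ.measurableSet]
    exact (le_of_eq h1.symm).trans h
  by_cases hint : IntegrableOn e (((fun y => b + y) '' L) ∩ Ω) μH[d]
  · rwa [← ofReal_integral_eq_lintegral_ofReal hint (.of_forall he),
      ENNReal.ofReal_le_ofReal_iff hM] at h2
  · rwa [integral_undef hint]

/-- If the edges of a grid carry little energy and avoid the boundary points where `u` is far from
the unit circle, then `|u| > 5/8` on the edges. -/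
lemma norm_gt_of_mem_edges {Ω : Set E3} {u : E3 → ℂ} {A : E3 → E3} {ε δ M : ℝ} (hΩ : IsOpen Ω)
    (hb : Bornology.IsBounded Ω) (hu : ContDiffOn ℝ 1 u (closure Ω))
    (hA : ContDiffOn ℝ 1 A (closure Ω)) (hε : 0 < ε) (hM : 6 * ε * M ≤ 1 / 20) {b : E3}
    (hhit : ∀ y ∈ latticeEdges δ, b + y ∉ {x | x ∈ frontier Ω ∧ 1 / 10 ≤ wellDepth (u x)})
    (hedge : ∫⁻ y in latticeEdges δ,
      Ω.indicator (fun x => ENNReal.ofReal (eDensity3 ε u A x)) (b + y) ∂μH[1] ≤ ENNReal.ofReal M)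
    {y : E3} (hy : y ∈ latticeEdges δ) (hyΩ : b + y ∈ Ω) : 5 / 8 < ‖u (b + y)‖ := by
  by_contra! hcon
  obtain ⟨k, hk⟩ := exists_line_subset_latticeEdges hy
  have hv : ‖EuclideanSpace.single k (1 : ℝ)‖ = 1 := by simp
  obtain ⟨l, hl, hlf, hlin⟩ := exists_exit hΩ hb hyΩ hv
  have hosc := (wellDepth_oscillation_le (A := A) hΩ hu hε hv hl hlin).trans (mul_le_mul_right
    ((lintegral_segment_le_lintegral_latticeEdges
      (measurable_indicator_eDensity3 hΩ hu hA ε) hk _).trans hedge) _)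
  rw [← ENNReal.ofReal_mul (by positivity)] at hosc
  have hosc' := hosc.trans (ENNReal.ofReal_le_ofReal hM)
  rw [ENNReal.ofReal_le_ofReal_iff (by norm_num)] at hosc'
  have hx := le_wellDepth_of_norm_le hcon
  refine hhit _ (hk l) ⟨by rwa [← add_assoc], ?_⟩
  rw [← add_assoc]
  have := neg_abs_le (wellDepth (u (b + y + l • EuclideanSpace.single k (1 : ℝ)))
    - wellDepth (u (b + y)))
  linarith

lemma mem_ball_of_mem_cube {a b : E3} {δ ρ : ℝ} (hδ : 0 < δ) (hρ : 2 * δ ≤ ρ)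
    (hb : ∀ i, b i ∈ Set.Ico (a i) (a i + δ)) : b ∈ ball a ρ := by
  rw [mem_ball, dist_eq_norm]
  have h1 : ‖b - a‖ ^ 2 < (2 * δ) ^ 2 := by
    rw [EuclideanSpace.norm_sq_eq, Fin.sum_univ_three]
    have h2 : ∀ i, ‖(b - a) i‖ ^ 2 ≤ δ ^ 2 := fun i => by
      have h3 := hb i
      rw [Real.norm_eq_abs, sq_abs, PiLp.sub_apply]
      nlinarith [h3.1, h3.2]
    have := h2 0
    have := h2 1
    have := h2 2
    nlinarith
  exact (lt_of_pow_lt_pow_left₀ 2 (by positivity) h1).trans_le hρ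

lemma energy_scaling {ε γ F : ℝ} (hε : 0 < ε) (hF : F ≤ ε ^ (-γ)) :
    ε * F ≤ (ε ^ ((1 - γ) / 4)) ^ 4 := by
  rw [← Real.rpow_natCast, ← Real.rpow_mul hε.le]
  calc ε * F ≤ ε * ε ^ (-γ) := by gcongr
    _ = ε ^ (1 + -γ) := by rw [Real.rpow_add hε, Real.rpow_one]
    _ = _ := by congr 1; push_cast; ring

lemma isCompact_frontier_wellDepth_ge {Ω : Set E3} {u : E3 → ℂ} (hb : Bornology.IsBounded Ω)
    (hu : ContDiffOn ℝ 1 u (closure Ω)) :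
    IsCompact {x | x ∈ frontier Ω ∧ 1 / 10 ≤ wellDepth (u x)} := by
  have hc : IsCompact (frontier Ω) :=
    hb.isCompact_closure.of_isClosed_subset isClosed_frontier frontier_subset_closure
  have hcont : ContinuousOn (fun x => wellDepth (u x)) (frontier Ω) :=
    continuous_wellDepth.comp_continuousOn (hu.continuousOn.mono frontier_subset_closure)
  exact hc.of_isClosed_subset
    (hcont.preimage_isClosed_of_isClosed isClosed_frontier isClosed_Ici) fun x hx => hx.1

/-- In the admissible range of scales, the boundary points where `u` is far from the unit circle
form a set of area small compared with `δ ^ 2`. -/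
lemma hausdorffMeasure_frontier_wellDepth_ge_le {Ω : Set E3} {u : E3 → ℂ} {A : E3 → E3}
    {ε δ X : ℝ} (hΩ : IsOpen Ω) (hb : Bornology.IsBounded Ω) (hu : ContDiffOn ℝ 1 u (closure Ω))
    (hA : ContDiffOn ℝ 1 A (closure Ω)) (hε : 0 < ε) (hε1 : ε ≤ 1) (hδ : 0 < δ) (hδ1 : δ ≤ 1)
    (hX : 0 ≤ X) (hXδ : X ≤ δ) (hεF : ε * freeEnergy3 ε u A Ω ≤ X ^ 4) {K : ℝ≥0}
    (hK : ∀ S ⊆ frontier Ω, ∀ H : E3 → ℝ≥0∞, Measurable H → SegmentMassBound Ω S H →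
      μH[2] S ≤ K * ∫⁻ x, H x) (hδK : 7200 * K * δ ≤ 1) :
    9 * ENNReal.ofReal δ * μH[2] {x | x ∈ frontier Ω ∧ 1 / 10 ≤ wellDepth (u x)}
      ≤ ENNReal.ofReal (δ ^ 3 / 4) := by
  have hmeas := measurable_indicator_eDensity3 hΩ hu hA ε
  have hF := freeEnergy3_nonneg ε u A Ω
  have h1 := hK _ (fun x hx => hx.1) _ (hmeas.const_mul _)
    (segmentMassBound_wellDepth (A := A) hΩ hu hε hε1)
  rw [lintegral_const_mul _ hmeas] at h1
  have h2 := h1.trans (mul_le_mul_right (mul_le_mul_right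
    (lintegral_indicator_eDensity3_le hΩ hb hu hA ε) (ENNReal.ofReal (100 * ε))) (K : ℝ≥0∞))
  refine (mul_le_mul_right h2 _).trans ?_
  rw [← ENNReal.ofReal_coe_nnreal, ← ENNReal.ofReal_ofNat 9, ← ENNReal.ofReal_mul (by positivity),
    ← ENNReal.ofReal_mul (by positivity), ← ENNReal.ofReal_mul (by positivity),
    ← ENNReal.ofReal_mul (by positivity)]
  refine ENNReal.ofReal_le_ofReal ?_
  calc 9 * δ * (K * (100 * ε * (2 * freeEnergy3 ε u A Ω)))
      = 1800 * K * δ * (ε * freeEnergy3 ε u A Ω) := by ring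
    _ ≤ 1800 * K * δ * δ ^ 4 := by
        gcongr
        exact hεF.trans (by gcongr)
    _ = (7200 * K * δ) * (δ ^ 4 / 4) := by ring
    _ ≤ 1 * (δ ^ 3 / 4) := by
        have : δ ^ 4 ≤ δ ^ 3 := pow_le_pow_of_le_one hδ.le hδ1 (by norm_num)
        gcongr
    _ = δ ^ 3 / 4 := one_mul _

/-- Choice of the grid: for configurations of bounded free energy, a
grid of side length `δ` can be positioned so that `|u| > 5/8` on its edges and the
energy on the edges (resp. faces) is controlled by `δ⁻² F_ε` (resp. `δ⁻¹ F_ε`). -/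
theorem stmt17 :
    ∃ C : ℝ, 0 < C ∧
      ∀ γ : ℝ, 0 < γ → γ < 1 →
      ∃ R₀ : EuclideanSpace ℝ (Fin 3) ≃ₗᵢ[ℝ] EuclideanSpace ℝ (Fin 3),
        LinearMap.det (R₀.toLinearEquiv : EuclideanSpace ℝ (Fin 3) →ₗ[ℝ]
          EuclideanSpace ℝ (Fin 3)) = 1 ∧
      ∃ c₀ c₁ : ℝ, 0 < c₀ ∧ 0 < c₁ ∧
      ∀ Ω : Set (EuclideanSpace ℝ (Fin 3)),
        IsOpen Ω → Bornology.IsBounded Ω → IsConnected Ω → HasLipschitzBoundary Ω →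
      ∃ δ₀ : ℝ, δ₀ ∈ Set.Ioo (0 : ℝ) 1 ∧
      ∀ ε δ : ℝ, 0 < ε → 0 < δ →
        ε ^ ((1 - γ) / 2) ≤ c₀ → c₁ * ε ^ ((1 - γ) / 4) ≤ δ → δ ≤ δ₀ →
      ∀ (u : EuclideanSpace ℝ (Fin 3) → ℂ)
        (A : EuclideanSpace ℝ (Fin 3) → EuclideanSpace ℝ (Fin 3)),
        ContDiffOn ℝ 1 u (closure Ω) → ContDiffOn ℝ 1 A (closure Ω) →
        freeEnergy3 ε u A Ω ≤ ε ^ (-γ) →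
      ∃ b ∈ Ω,
        -- (i) `|u| > 5/8` on the edges of the grid inside `Ω`
        (∀ x ∈ ((fun y => b + R₀ y) '' latticeEdges δ) ∩ Ω, 5 / 8 < ‖u x‖) ∧
        -- (ii) the energy on the edges is bounded by `C δ⁻² F_ε(u,A)`
        (∫ x in ((fun y => b + R₀ y) '' latticeEdges δ) ∩ Ω, eDensity3 ε u A x ∂(μH[1]))
          ≤ C * (δ ^ 2)⁻¹ * freeEnergy3 ε u A Ω ∧
        -- (iii) the energy on the faces is bounded by `C δ⁻¹ F_ε(u,A)`
        (∫ x in ((fun y => b + R₀ y) '' latticeFaces δ) ∩ Ω, eDensity3 ε u A x ∂(μH[2]))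
          ≤ C * δ⁻¹ * freeEnergy3 ε u A Ω := by
  refine ⟨72, by norm_num, fun γ hγ hγ1 => ⟨LinearIsometryEquiv.refl ℝ _, LinearMap.det_id,
    1 / 3000, 1, by norm_num, one_pos, fun Ω hΩ hb hconn hL => ?_⟩⟩
  obtain ⟨K, hK⟩ := exists_trace_bound hΩ hb hL
  obtain ⟨a, ha⟩ := hconn.nonempty
  obtain ⟨ρ, hρ, hball⟩ := Metric.isOpen_iff.1 hΩ a ha
  have hK0 : (0 : ℝ) ≤ K := K.coe_nonneg
  refine ⟨min (ρ / 2) (1 / (7200 * (K + 1))), ⟨lt_min (by positivity) (by positivity),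
    (min_le_right _ _).trans_lt ((div_lt_one (by positivity)).2 (by linarith))⟩, ?_⟩
  intro ε δ hε hδ hc₀ hc₁ hδ₀ u A hu hA hF
  have hδρ : 2 * δ ≤ ρ := by linarith [hδ₀.trans (min_le_left _ _)]
  have hδK' : δ * (7200 * (K + 1)) ≤ 1 :=
    (le_div_iff₀ (by positivity)).1 (hδ₀.trans (min_le_right _ _))
  have hδ1 : δ ≤ 1 := by nlinarith
  have hδK : 7200 * K * δ ≤ 1 := by linarith
  have hε1 : ε ≤ 1 := by
    by_contra! h
    have := Real.one_lt_rpow h (show 0 < (1 - γ) / 2 by linarith)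
    linarith
  have hεF := energy_scaling hε hF
  have hXsq : (ε ^ ((1 - γ) / 4)) ^ 2 ≤ 1 / 3000 := by
    rw [← Real.rpow_natCast, ← Real.rpow_mul hε.le]
    convert hc₀ using 2
    push_cast
    ring
  rw [one_mul] at hc₁
  set X := ε ^ ((1 - γ) / 4) with hXdef
  have hX : 0 < X := Real.rpow_pos_of_pos hε _
  set F := freeEnergy3 ε u A Ω with hFdef
  have hF0 : 0 ≤ F := freeEnergy3_nonneg ε u A Ω
  obtain ⟨b, hbQ, hhit, hedge, hface⟩ := exists_good_translation hδ hF0 a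
    (isCompact_frontier_wellDepth_ge hb hu)
    (hausdorffMeasure_frontier_wellDepth_ge_le hΩ hb hu hA hε hε1 hδ hδ1 hX.le hc₁ hεF hK hδK)
    (measurable_indicator_eDensity3 hΩ hu hA ε) (lintegral_indicator_eDensity3_le hΩ hb hu hA ε)
  have hnn := eDensity3_nonneg ε u A
  refine ⟨b, hball (mem_ball_of_mem_cube hδ hδρ hbQ), ?_, ?_, ?_⟩
  · rintro _ ⟨⟨y, hy, rfl⟩, hyΩ⟩
    refine norm_gt_of_mem_edges hΩ hb hu hA hε ?_ hhit hedge hy hyΩ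
    have h4 : ε * F * (δ ^ 2)⁻¹ ≤ X ^ 2 := by
      rw [← div_eq_mul_inv, div_le_iff₀ (by positivity)]
      calc ε * F ≤ X ^ 2 * X ^ 2 := by linarith
        _ ≤ X ^ 2 * δ ^ 2 := by gcongr
    linarith
  · refine (integral_translate_inter_le (by positivity) hΩ hnn hedge).trans ?_
    gcongr
    norm_num
  · exact integral_translate_inter_le (by positivity) hΩ hnn hface
end
end
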